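/- arXiv:1407.7662 — 6 statements merged into one kernel-verified Lean document; each statement's English description precedes it below -/
import Mathlib

section
/- Let (X_n)_{n∈ℕ}, (Y_n)_{n∈ℕ} be integer-valued random variables and (Z_n)_{n∈ℕ} random elements on a common probability space, and let X, Y be integer-valued random variables such that (X_n,Y_n) converges in distribution to (X,Y) conditioned on Z_n. Then, as n→∞, the random variables 3·E[𝓕_{X_n|Z_n}(X_n)·𝓕_{Y_n|Z_n}(Y_n) | σ(Z_n)] − 3 converge in probability to Spearman's rho ρ(X,Y) = 3·E[𝓕_X(X)𝓕_Y(Y)] − 3. -/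
open MeasureTheory Filter

/-- `F_X(k) = P(X ≤ k)` for an integer-valued random variable. -/
noncomputable def intCdf {Ω : Type*} [MeasurableSpace Ω] (μ : Measure Ω)
    (X : Ω → ℤ) (k : ℤ) : ℝ :=
  (μ {ω | X ω ≤ k}).toReal

/-- `𝓕_X(k) = F_X(k) + F_X(k-1)`. -/
noncomputable def scriptF {Ω : Type*} [MeasurableSpace Ω] (μ : Measure Ω)
    (X : Ω → ℤ) (k : ℤ) : ℝ :=
  intCdf μ X k + intCdf μ X (k - 1)

/-- Spearman's rho of an integer-valued pair: `ρ(X,Y) = 3·E[𝓕_X(X)𝓕_Y(Y)] − 3`. -/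
noncomputable def spearman {Ω : Type*} [MeasurableSpace Ω] (μ : Measure Ω)
    (X Y : Ω → ℤ) : ℝ :=
  3 * ∫ ω, scriptF μ X (X ω) * scriptF μ Y (Y ω) ∂μ - 3

/-- Conditional cdf `F_{X|Z}(k)`: a version of `E[1{X ≤ k} | 𝔪]`. -/
noncomputable def condIntCdf {Ω : Type*} [MeasurableSpace Ω] (μ : Measure Ω)
    (𝔪 : MeasurableSpace Ω) (X : Ω → ℤ) (k : ℤ) : Ω → ℝ :=
  μ[(fun ω => if X ω ≤ k then (1 : ℝ) else 0) | 𝔪]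

/-- `𝓕_{X|Z}(X)(ω) = F_{X|Z}(X(ω))(ω) + F_{X|Z}(X(ω) − 1)(ω)`. -/
noncomputable def condScriptF {Ω : Type*} [𝔪₀ : MeasurableSpace Ω] (μ : Measure Ω)
    (𝔪 : MeasurableSpace Ω) (X : Ω → ℤ) : Ω → ℝ := fun ω =>
  @condIntCdf Ω 𝔪₀ μ 𝔪 X (X ω) ω + @condIntCdf Ω 𝔪₀ μ 𝔪 X (X ω - 1) ω

open Topology

lemma L1_of_inMeasure {Ω : Type*} [MeasurableSpace Ω] (μ : Measure Ω) [IsProbabilityMeasure μ]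
    (f : ℕ → Ω → ℝ) (c D : ℝ) (hf : ∀ n, Measurable (f n))
    (hD : ∀ n, ∀ᵐ ω ∂μ, |f n ω - c| ≤ D)
    (h : TendstoInMeasure μ f atTop (fun _ => c)) :
    Tendsto (fun n => ∫ ω, |f n ω - c| ∂μ) atTop (𝓝 0) := by
  have hD0 : 0 ≤ D := by
    obtain ⟨ω, hω⟩ := (hD 0).exists
    exact (abs_nonneg _).trans hω
  rw [tendstoInMeasure_iff_measureReal_norm] at h
  rw [Metric.tendsto_atTop]
  intro ε hε
  have h1 := (h (ε / 2) (by positivity)).const_mul D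
  rw [mul_zero] at h1
  have h2 := h1.eventually (gt_mem_nhds (show (0:ℝ) < ε / 2 by positivity))
  obtain ⟨N, hN⟩ := eventually_atTop.1 h2
  refine ⟨N, fun n hn => ?_⟩
  rw [Real.dist_eq, sub_zero, abs_of_nonneg (integral_nonneg fun _ => abs_nonneg _)]
  set S := {x | ε / 2 ≤ ‖f n x - c‖} with hS
  have hSm : MeasurableSet S :=
    measurableSet_le measurable_const ((hf n).sub measurable_const).norm
  have hint : Integrable (fun ω => ε / 2 + S.indicator (fun _ => D) ω) μ :=
    (integrable_const _).add ((integrable_const _).indicator hSm)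
  calc ∫ ω, |f n ω - c| ∂μ ≤ ∫ ω, (ε / 2 + S.indicator (fun _ => D) ω) ∂μ := by
        refine integral_mono_of_nonneg (Eventually.of_forall fun _ => abs_nonneg _) hint ?_
        filter_upwards [hD n] with ω hω
        by_cases hx : ω ∈ S
        · simp only [Set.indicator_of_mem hx]; linarith
        · simp only [Set.indicator_of_notMem hx]
          simp only [hS, Set.mem_ofPred_eq, not_le, Real.norm_eq_abs] at hx
          linarith
    _ = ε / 2 + D * μ.real S := by
        rw [integral_add (integrable_const _) ((integrable_const _).indicator hSm),
          integral_indicator hSm]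
        simp [mul_comm]
    _ < ε := by have := hN n hn; linarith

lemma inMeasure_of_L1 {Ω : Type*} [MeasurableSpace Ω] (μ : Measure Ω) [IsProbabilityMeasure μ]
    (f : ℕ → Ω → ℝ) (c : ℝ) (hf : ∀ n, Integrable (f n) μ)
    (h : Tendsto (fun n => ∫ ω, |f n ω - c| ∂μ) atTop (𝓝 0)) :
    TendstoInMeasure μ f atTop (fun _ => c) := by
  rw [tendstoInMeasure_iff_measureReal_norm]
  intro ε hε
  have h1 := h.const_mul ε⁻¹
  rw [mul_zero] at h1
  refine squeeze_zero (fun _ => measureReal_nonneg) (fun n => ?_) h1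
  have := mul_meas_ge_le_integral_of_nonneg (μ := μ) (f := fun ω => |f n ω - c|)
    (Eventually.of_forall fun _ => abs_nonneg _) ((hf n).sub (integrable_const c)).abs ε
  simp only [Real.norm_eq_abs]
  rw [inv_mul_eq_div, le_div_iff₀ hε]
  linarith

lemma abs_condExp_le {Ω : Type*} {m0 : MeasurableSpace Ω} (μ : Measure Ω)
    (m : MeasurableSpace Ω) (f : Ω → ℝ) (C : ℝ) (hf : ∀ᵐ ω ∂μ, |f ω| ≤ C) (hC : 0 ≤ C) :
    ∀ᵐ ω ∂μ, |(μ[f | m]) ω| ≤ C :=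
  ae_bdd_condExp_of_ae_bdd (R := ⟨C, hC⟩) hf

/-- conditional convergence for all bounded functions on `ℤ × ℤ`, in `L¹`. -/
lemma key_L1 {Ω : Type*} [MeasurableSpace Ω] (μ : Measure Ω)
    [IsProbabilityMeasure μ]
    (X Y : Ω → ℤ) (Xn Yn : ℕ → Ω → ℤ) (𝔪 : ℕ → MeasurableSpace Ω)
    (h𝔪 : ∀ n, 𝔪 n ≤ ‹MeasurableSpace Ω›)
    (hconv : ∀ h : BoundedContinuousFunction (ℝ × ℝ) ℝ,
      TendstoInMeasure μ
        (fun n => μ[(fun ω => h ((Xn n ω : ℝ), (Yn n ω : ℝ))) | 𝔪 n]) atTop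
        (fun _ => ∫ ω, h ((X ω : ℝ), (Y ω : ℝ)) ∂μ))
    (g : ℤ × ℤ → ℝ) (C : ℝ) (hg : ∀ p, |g p| ≤ C) :
    Tendsto (fun n => ∫ ω, |(μ[(fun ω => g (Xn n ω, Yn n ω)) | 𝔪 n]) ω
      - ∫ ω, g (X ω, Y ω) ∂μ| ∂μ) atTop (𝓝 0) := by
  have hC : 0 ≤ C := (abs_nonneg _).trans (hg 0)
  obtain ⟨h, -, hh⟩ := BoundedContinuousFunction.exists_extension_norm_eq_of_isClosedEmbedding
    (BoundedContinuousFunction.ofNormedAddCommGroup g continuous_of_discreteTopology C hg)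
    (Int.isClosedEmbedding_coe_real.prodMap Int.isClosedEmbedding_coe_real)
  have hh' : ∀ a b : ℤ, h ((a : ℝ), (b : ℝ)) = g (a, b) := fun a b => congrFun hh (a, b)
  have h1 := hconv h
  simp only [hh'] at h1
  refine L1_of_inMeasure μ _ _ (C + C) (fun n => ?_) (fun n => ?_) h1
  · exact (stronglyMeasurable_condExp.mono (h𝔪 n)).measurable
  · filter_upwards [abs_condExp_le μ (𝔪 n) (fun ω => g (Xn n ω, Yn n ω)) C
      (Eventually.of_forall fun _ => hg _) hC] with ω hω
    refine (abs_sub _ _).trans (add_le_add hω ?_)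
    have := norm_integral_le_of_norm_le_const (μ := μ) (f := fun ω => g (X ω, Y ω)) (C := C)
      (Eventually.of_forall fun _ => hg _)
    simpa using this

lemma integral_tendsto {Ω : Type*} [MeasurableSpace Ω] (μ : Measure Ω)
    [IsProbabilityMeasure μ] (X : Ω → ℤ) (Xn : ℕ → Ω → ℤ) (𝔪 : ℕ → MeasurableSpace Ω)
    (h𝔪 : ∀ n, 𝔪 n ≤ ‹MeasurableSpace Ω›) (g : ℤ → ℝ)
    (h : Tendsto (fun n => ∫ ω, |(μ[(fun ω => g (Xn n ω)) | 𝔪 n]) ω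
      - ∫ ω, g (X ω) ∂μ| ∂μ) atTop (𝓝 0)) :
    Tendsto (fun n => ∫ ω, g (Xn n ω) ∂μ) atTop (𝓝 (∫ ω, g (X ω) ∂μ)) := by
  rw [tendsto_iff_dist_tendsto_zero]
  refine squeeze_zero (fun _ => dist_nonneg) (fun n => ?_) h
  rw [Real.dist_eq, ← integral_condExp (h𝔪 n)]
  calc _ = |∫ ω, ((μ[(fun ω => g (Xn n ω)) | 𝔪 n]) ω - ∫ ω, g (X ω) ∂μ) ∂μ| := by
        rw [integral_sub integrable_condExp (integrable_const _)]
        simp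
    _ ≤ _ := abs_integral_le_integral_abs

lemma exists_finset_tail {Ω : Type*} [MeasurableSpace Ω] (μ : Measure Ω)
    [IsProbabilityMeasure μ] (X : Ω → ℤ) (hX : Measurable X) (ε : ℝ) (hε : 0 < ε) :
    ∃ s : Finset ℤ, ∫ ω, (if X ω ∈ s then (0:ℝ) else 1) ∂μ < ε := by
  have : IsProbabilityMeasure (μ.map X) := Measure.isProbabilityMeasure_map hX.aemeasurable
  obtain ⟨K, hK, hK'⟩ := isTightMeasureSet_iff_exists_isCompact_measure_compl_le.1
    (isTightMeasureSet_singleton (μ := μ.map X)) (ENNReal.ofReal (ε / 2)) (by simp; positivity)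
  have hf := hK.finite_of_discrete
  refine ⟨hf.toFinset, ?_⟩
  have h1 := hK' _ rfl
  rw [Measure.map_apply hX (MeasurableSet.of_discrete)] at h1
  have h2 : (fun ω => if X ω ∈ hf.toFinset then (0:ℝ) else 1) = (X ⁻¹' Kᶜ).indicator 1 := by
    ext ω
    by_cases h : X ω ∈ K <;> simp [h]
  rw [h2, integral_indicator_one (hX MeasurableSet.of_discrete)]
  have := ENNReal.toReal_le_of_le_ofReal (by positivity) h1
  rw [measureReal_def]
  linarith

lemma measurable_condIntCdf_comp {Ω : Type*} (m : MeasurableSpace Ω) [m0 : MeasurableSpace Ω] (μ : Measure Ω)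
     (hm : m ≤ m0) (X N : Ω → ℤ) (hN : @Measurable _ _ m0 _ N) :
    @Measurable _ _ m0 _ (fun ω => @condIntCdf Ω m0 μ m X (N ω) ω) := by
  have h1 : @Measurable (ℤ × Ω) ℝ (@Prod.instMeasurableSpace _ _ _ m0) _
      (fun p => @condIntCdf Ω m0 μ m X p.1 p.2) :=
    measurable_from_prod_countable_right fun k =>
      (show StronglyMeasurable[m] (@condIntCdf Ω m0 μ m X k) from
        stronglyMeasurable_condExp).measurable.mono hm le_rfl
  exact h1.comp (hN.prodMk measurable_id)

lemma condIntCdf_bound {Ω : Type*} (m : MeasurableSpace Ω) [m0 : MeasurableSpace Ω] (μ : Measure Ω)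
     (X : Ω → ℤ) :
    ∀ᵐ ω ∂μ, ∀ k, |@condIntCdf Ω m0 μ m X k ω| ≤ 1 := by
  rw [ae_all_iff]
  intro k
  refine abs_condExp_le μ m _ 1 (Eventually.of_forall fun ω => ?_) zero_le_one
  split_ifs <;> simp

lemma intCdf_bound {Ω : Type*} [m0 : MeasurableSpace Ω] (μ : Measure Ω) [IsProbabilityMeasure μ]
    (X : Ω → ℤ) (k : ℤ) : |intCdf μ X k| ≤ 1 := by
  unfold intCdf
  rw [abs_of_nonneg ENNReal.toReal_nonneg]
  exact measureReal_le_one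

lemma integrable_diff {Ω : Type*} (m : MeasurableSpace Ω) [m0 : MeasurableSpace Ω] (μ : Measure Ω)
    [IsProbabilityMeasure μ]  (hm : m ≤ m0) (X X' N : Ω → ℤ)
    (hN : @Measurable _ _ m0 _ N) :
    Integrable (fun ω => @condIntCdf Ω m0 μ m X (N ω) ω - @intCdf Ω m0 μ X' (N ω)) μ := by
  refine Integrable.of_bound (C := 2) ?_ ?_
  · refine (Measurable.sub (measurable_condIntCdf_comp m μ hm X N hN) ?_).aestronglyMeasurable
    exact (measurable_from_top (f := fun k => @intCdf Ω m0 μ X' k)).comp hN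
  · filter_upwards [condIntCdf_bound m μ X] with ω hω
    rw [Real.norm_eq_abs]
    have := hω (N ω)
    have h2 := intCdf_bound μ X' (N ω)
    exact (abs_sub _ _).trans (by linarith)

lemma cdf_L1 {Ω : Type*} [m0 : MeasurableSpace Ω] (μ : Measure Ω)
    [IsProbabilityMeasure μ] (X : Ω → ℤ) (Xn : ℕ → Ω → ℤ) (𝔪 : ℕ → MeasurableSpace Ω)
    (h𝔪 : ∀ n, 𝔪 n ≤ m0) (hX : @Measurable _ _ m0 _ X) (hXn : ∀ n, @Measurable _ _ m0 _ (Xn n))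
    (h : ∀ g : ℤ → ℝ, (∀ k, |g k| ≤ 1) →
      Tendsto (fun n => ∫ ω, |(μ[(fun ω => g (Xn n ω)) | 𝔪 n]) ω
      - ∫ ω, g (X ω) ∂μ| ∂μ) atTop (𝓝 0)) (j : ℤ) :
    Tendsto (fun n => ∫ ω, |@condIntCdf Ω m0 μ (𝔪 n) (Xn n) (Xn n ω - j) ω
      - @intCdf Ω m0 μ X (Xn n ω - j)| ∂μ) atTop (𝓝 0) := by
  have hk : ∀ k : ℤ, Tendsto (fun n => ∫ ω, |@condIntCdf Ω m0 μ (𝔪 n) (Xn n) k ω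
      - @intCdf Ω m0 μ X k| ∂μ) atTop (𝓝 0) := by
    intro k
    have h1 := h (fun i => if i ≤ k then 1 else 0) (fun i => by split_ifs <;> simp)
    have h2 : ∫ ω, (if X ω ≤ k then (1:ℝ) else 0) ∂μ = @intCdf Ω m0 μ X k := by
      have hS : MeasurableSet {ω | X ω ≤ k} := hX (MeasurableSet.of_discrete (s := Set.Iic k))
      have := integral_indicator_one (μ := μ) hS
      rw [measureReal_def] at this
      rw [intCdf, ← this]
      congr 1
      ext ω
      simp [Set.indicator_apply]
    rw [h2] at h1
    exact h1
  rw [Metric.tendsto_atTop]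
  intro ε hε
  obtain ⟨s, hs⟩ := exists_finset_tail μ X hX (ε / 4) (by positivity)
  have ht : Tendsto (fun n => ∫ ω, (if Xn n ω ∈ s then (0:ℝ) else 1) ∂μ) atTop
      (𝓝 (∫ ω, (if X ω ∈ s then (0:ℝ) else 1) ∂μ)) := by
    have hb : ∀ i : ℤ, |if i ∈ s then (0:ℝ) else 1| ≤ 1 := fun i => by split_ifs <;> simp
    exact integral_tendsto μ X Xn 𝔪 h𝔪 (fun i => if i ∈ s then (0:ℝ) else 1)
      (h (fun i => if i ∈ s then (0:ℝ) else 1) hb)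
  have hsum : Tendsto (fun n => ∑ k ∈ s, ∫ ω, |@condIntCdf Ω m0 μ (𝔪 n) (Xn n) (k - j) ω
      - @intCdf Ω m0 μ X (k - j)| ∂μ) atTop (𝓝 0) := by
    have h3 := tendsto_finsetSum s (fun k _ => hk (k - j))
    rw [Finset.sum_const_zero] at h3
    exact h3
  obtain ⟨N, hN⟩ := eventually_atTop.1 ((ht.eventually (gt_mem_nhds hs)).and
    (hsum.eventually (gt_mem_nhds (show (0:ℝ) < ε / 2 by positivity))))
  refine ⟨N, fun n hn => ?_⟩
  obtain ⟨hn1, hn2⟩ := hN n hn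
  rw [Real.dist_eq, sub_zero, abs_of_nonneg (integral_nonneg fun _ => abs_nonneg _)]
  have i1 : ∀ k ∈ s, Integrable (fun ω => |@condIntCdf Ω m0 μ (𝔪 n) (Xn n) (k - j) ω
      - @intCdf Ω m0 μ X (k - j)|) μ := fun k _ =>
    (integrable_diff (𝔪 n) μ (h𝔪 n) (Xn n) X (fun _ => k - j) measurable_const).abs
  have i2 : Integrable (fun ω => if Xn n ω ∈ s then (0:ℝ) else 1) μ := by
    refine Integrable.of_bound (C := 1) ?_ (Eventually.of_forall fun ω => ?_)
    · exact ((measurable_from_top (f := fun k => if k ∈ s then (0:ℝ) else 1)).comp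
        (hXn n)).aestronglyMeasurable
    · split_ifs <;> simp
  calc ∫ ω, |@condIntCdf Ω m0 μ (𝔪 n) (Xn n) (Xn n ω - j) ω
      - @intCdf Ω m0 μ X (Xn n ω - j)| ∂μ
      ≤ ∫ ω, ((∑ k ∈ s, |@condIntCdf Ω m0 μ (𝔪 n) (Xn n) (k - j) ω
      - @intCdf Ω m0 μ X (k - j)|) + 2 * (if Xn n ω ∈ s then (0:ℝ) else 1)) ∂μ := by
        refine integral_mono_of_nonneg (Eventually.of_forall fun _ => abs_nonneg _)
          ((integrable_finsetSum s i1).add (i2.const_mul 2)) ?_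
        filter_upwards [condIntCdf_bound (𝔪 n) μ (Xn n)] with ω hω
        by_cases hx : Xn n ω ∈ s
        · simp only [hx, if_true, mul_zero, add_zero]
          exact Finset.single_le_sum (f := fun k => |@condIntCdf Ω m0 μ (𝔪 n) (Xn n) (k - j) ω
            - @intCdf Ω m0 μ X (k - j)|) (fun _ _ => abs_nonneg _) hx
        · simp only [hx, if_false, mul_one]
          have h1 := hω (Xn n ω - j)
          have h2 := intCdf_bound μ X (Xn n ω - j)
          have h3 := abs_sub (@condIntCdf Ω m0 μ (𝔪 n) (Xn n) (Xn n ω - j) ω)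
            (@intCdf Ω m0 μ X (Xn n ω - j))
          have h4 : 0 ≤ ∑ k ∈ s, |@condIntCdf Ω m0 μ (𝔪 n) (Xn n) (k - j) ω
            - @intCdf Ω m0 μ X (k - j)| := Finset.sum_nonneg fun _ _ => abs_nonneg _
          linarith
    _ = ∑ k ∈ s, ∫ ω, |@condIntCdf Ω m0 μ (𝔪 n) (Xn n) (k - j) ω
      - @intCdf Ω m0 μ X (k - j)| ∂μ + 2 * ∫ ω, (if Xn n ω ∈ s then (0:ℝ) else 1) ∂μ := by
        rw [integral_add (integrable_finsetSum s i1) (i2.const_mul 2),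
          integral_finsetSum s i1, integral_const_mul]
    _ < ε := by linarith

lemma scriptF_L1 {Ω : Type*} [m0 : MeasurableSpace Ω] (μ : Measure Ω)
    [IsProbabilityMeasure μ] (X : Ω → ℤ) (Xn : ℕ → Ω → ℤ) (𝔪 : ℕ → MeasurableSpace Ω)
    (h𝔪 : ∀ n, 𝔪 n ≤ m0) (hX : @Measurable _ _ m0 _ X) (hXn : ∀ n, @Measurable _ _ m0 _ (Xn n))
    (h : ∀ g : ℤ → ℝ, (∀ k, |g k| ≤ 1) →
      Tendsto (fun n => ∫ ω, |(μ[(fun ω => g (Xn n ω)) | 𝔪 n]) ω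
      - ∫ ω, g (X ω) ∂μ| ∂μ) atTop (𝓝 0)) :
    Tendsto (fun n => ∫ ω, |@condScriptF Ω m0 μ (𝔪 n) (Xn n) ω
      - @scriptF Ω m0 μ X (Xn n ω)| ∂μ) atTop (𝓝 0) := by
  have h0 := cdf_L1 μ X Xn 𝔪 h𝔪 hX hXn h 0
  have h1 := cdf_L1 μ X Xn 𝔪 h𝔪 hX hXn h 1
  simp only [sub_zero] at h0
  have h2 := h0.add h1
  rw [add_zero] at h2
  refine squeeze_zero (fun n => integral_nonneg fun _ => abs_nonneg _) (fun n => ?_) h2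
  have i0 := (integrable_diff (𝔪 n) μ (h𝔪 n) (Xn n) X (Xn n) (hXn n)).abs
  have i1 := (integrable_diff (𝔪 n) μ (h𝔪 n) (Xn n) X (fun ω => Xn n ω - 1)
    ((measurable_from_top (f := fun k : ℤ => k - 1)).comp (hXn n))).abs
  rw [← integral_add i0 i1]
  refine integral_mono_of_nonneg (Eventually.of_forall fun _ => abs_nonneg _) (i0.add i1)
    (Eventually.of_forall fun ω => ?_)
  simp only [condScriptF, scriptF]
  refine le_trans (le_of_eq ?_) (abs_add_le _ _)
  congr 1
  ring

lemma measurable_condScriptF {Ω : Type*} (m : MeasurableSpace Ω) [m0 : MeasurableSpace Ω] (μ : Measure Ω)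
     (hm : m ≤ m0) (X : Ω → ℤ) (hX : @Measurable _ _ m0 _ X) :
    @Measurable _ _ m0 _ (@condScriptF Ω m0 μ m X) :=
  (measurable_condIntCdf_comp m μ hm X X hX).add
    (measurable_condIntCdf_comp m μ hm X (fun ω => X ω - 1)
      ((measurable_from_top (f := fun k : ℤ => k - 1)).comp hX))

lemma condScriptF_bound {Ω : Type*} (m : MeasurableSpace Ω) [m0 : MeasurableSpace Ω] (μ : Measure Ω)
     (X : Ω → ℤ) :
    ∀ᵐ ω ∂μ, |@condScriptF Ω m0 μ m X ω| ≤ 2 := by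
  filter_upwards [condIntCdf_bound m μ X] with ω hω
  have h1 := hω (X ω)
  have h2 := hω (X ω - 1)
  exact (abs_add_le _ _).trans (by linarith)

lemma scriptF_bound {Ω : Type*} [m0 : MeasurableSpace Ω] (μ : Measure Ω) [IsProbabilityMeasure μ]
    (X : Ω → ℤ) (k : ℤ) : |scriptF μ X k| ≤ 2 := by
  have h1 := intCdf_bound μ X k
  have h2 := intCdf_bound μ X (k - 1)
  exact (abs_add_le _ _).trans (by linarith)

/-- If `(X_n, Y_n)` converges in distribution to `(X, Y)` conditioned on
`Z_n` (here represented by the sub-σ-algebras `𝔪 n = σ(Z_n)`), then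
`3·E[𝓕_{X_n|Z_n}(X_n)·𝓕_{Y_n|Z_n}(Y_n) | σ(Z_n)] − 3` converges in probability to
Spearman's rho `ρ(X,Y) = 3·E[𝓕_X(X)𝓕_Y(Y)] − 3`. -/
theorem spearman_consistency {Ω : Type*} [MeasurableSpace Ω] (μ : Measure Ω)
    [IsProbabilityMeasure μ]
    (X Y : Ω → ℤ) (Xn Yn : ℕ → Ω → ℤ) (𝔪 : ℕ → MeasurableSpace Ω)
    (h𝔪 : ∀ n, 𝔪 n ≤ ‹MeasurableSpace Ω›)
    (hX : Measurable X) (hY : Measurable Y)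
    (hXn : ∀ n, Measurable (Xn n)) (hYn : ∀ n, Measurable (Yn n))
    (hconv : ∀ h : BoundedContinuousFunction (ℝ × ℝ) ℝ,
      TendstoInMeasure μ
        (fun n => μ[(fun ω => h ((Xn n ω : ℝ), (Yn n ω : ℝ))) | 𝔪 n]) atTop
        (fun _ => ∫ ω, h ((X ω : ℝ), (Y ω : ℝ)) ∂μ)) :
    TendstoInMeasure μ
      (fun n ω =>
        3 * (μ[(fun ω' => condScriptF μ (𝔪 n) (Xn n) ω' * condScriptF μ (𝔪 n) (Yn n) ω') | 𝔪 n]) ω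
          - 3)
      atTop (fun _ => spearman μ X Y) := by
  rename_i m0 _
  have hkey := key_L1 μ X Y Xn Yn 𝔪 h𝔪 hconv
  have hU := scriptF_L1 μ X Xn 𝔪 h𝔪 hX hXn
    (fun g hg => hkey (fun p => g p.1) 1 (fun p => hg _))
  have hV := scriptF_L1 μ Y Yn 𝔪 h𝔪 hY hYn
    (fun g hg => hkey (fun p => g p.2) 1 (fun p => hg _))
  have hW := hkey (fun p => scriptF μ X p.1 * scriptF μ Y p.2) 4 (fun p => by
    rw [abs_mul]
    have := mul_le_mul (scriptF_bound μ X p.1) (scriptF_bound μ Y p.2) (abs_nonneg _) zero_le_two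
    linarith)
  have iUV : ∀ n, Integrable (fun ω => condScriptF μ (𝔪 n) (Xn n) ω
      * condScriptF μ (𝔪 n) (Yn n) ω) μ := fun n => by
    refine Integrable.of_bound (C := 4)
      ((measurable_condScriptF (𝔪 n) μ (h𝔪 n) (Xn n) (hXn n)).mul
      (measurable_condScriptF (𝔪 n) μ (h𝔪 n) (Yn n) (hYn n))).aestronglyMeasurable ?_
    filter_upwards [condScriptF_bound (𝔪 n) μ (Xn n), condScriptF_bound (𝔪 n) μ (Yn n)] with ω h1 h2
    rw [Real.norm_eq_abs, abs_mul]
    have := mul_le_mul h1 h2 (abs_nonneg _) zero_le_two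
    linarith
  have mu : ∀ n, Measurable (fun ω => scriptF μ X (Xn n ω)) := fun n =>
    (measurable_from_top (f := fun k => scriptF μ X k)).comp (hXn n)
  have mv : ∀ n, Measurable (fun ω => scriptF μ Y (Yn n ω)) := fun n =>
    (measurable_from_top (f := fun k => scriptF μ Y k)).comp (hYn n)
  have iuv : ∀ n, Integrable (fun ω => scriptF μ X (Xn n ω) * scriptF μ Y (Yn n ω)) μ := fun n => by
    refine Integrable.of_bound (C := 4) ((mu n).mul (mv n)).aestronglyMeasurable
      (Eventually.of_forall fun ω => ?_)
    rw [Real.norm_eq_abs, abs_mul]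
    have := mul_le_mul (scriptF_bound μ X (Xn n ω)) (scriptF_bound μ Y (Yn n ω))
      (abs_nonneg _) zero_le_two
    linarith
  have iU : ∀ n, Integrable (fun ω => |condScriptF μ (𝔪 n) (Xn n) ω - scriptF μ X (Xn n ω)|) μ :=
    fun n => by
    refine (Integrable.of_bound (C := 4) ((measurable_condScriptF (𝔪 n) μ (h𝔪 n) (Xn n)
      (hXn n)).sub (mu n)).aestronglyMeasurable ?_).abs
    filter_upwards [condScriptF_bound (𝔪 n) μ (Xn n)] with ω h1
    have := scriptF_bound μ X (Xn n ω)
    exact (abs_sub _ _).trans (by linarith)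
  have iV : ∀ n, Integrable (fun ω => |condScriptF μ (𝔪 n) (Yn n) ω - scriptF μ Y (Yn n ω)|) μ :=
    fun n => by
    refine (Integrable.of_bound (C := 4) ((measurable_condScriptF (𝔪 n) μ (h𝔪 n) (Yn n)
      (hYn n)).sub (mv n)).aestronglyMeasurable ?_).abs
    filter_upwards [condScriptF_bound (𝔪 n) μ (Yn n)] with ω h1
    have := scriptF_bound μ Y (Yn n ω)
    exact (abs_sub _ _).trans (by linarith)
  refine inMeasure_of_L1 μ _ _ (fun n => (integrable_condExp.const_mul 3).sub
    (integrable_const _)) ?_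
  have hlim := (((hU.const_mul 2).add (hV.const_mul 2)).add hW).const_mul 3
  simp only [mul_zero, add_zero] at hlim
  refine squeeze_zero (fun n => integral_nonneg fun _ => abs_nonneg _) (fun n => ?_) hlim
  -- the conditional expectation of the difference
  set A := fun ω => condScriptF μ (𝔪 n) (Xn n) ω * condScriptF μ (𝔪 n) (Yn n) ω with hA
  set B := fun ω => scriptF μ X (Xn n ω) * scriptF μ Y (Yn n ω) with hB
  set c := ∫ ω, scriptF μ X (X ω) * scriptF μ Y (Y ω) ∂μ with hc
  have hsub : μ[A - B | 𝔪 n] =ᵐ[μ] μ[A | 𝔪 n] - μ[B | 𝔪 n] := condExp_sub (iUV n) (iuv n) _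
  have e1 : ∫ ω, |(μ[A - B | 𝔪 n]) ω| ∂μ ≤ ∫ ω, |(A - B) ω| ∂μ := integral_abs_condExp_le _
  have e2 : ∫ ω, |(A - B) ω| ∂μ ≤
      2 * ∫ ω, |condScriptF μ (𝔪 n) (Xn n) ω - scriptF μ X (Xn n ω)| ∂μ +
      2 * ∫ ω, |condScriptF μ (𝔪 n) (Yn n) ω - scriptF μ Y (Yn n ω)| ∂μ := by
    rw [← integral_const_mul, ← integral_const_mul,
      ← integral_add ((iU n).const_mul 2) ((iV n).const_mul 2)]
    refine integral_mono_of_nonneg (Eventually.of_forall fun _ => abs_nonneg _)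
      (((iU n).const_mul 2).add ((iV n).const_mul 2)) ?_
    filter_upwards [condScriptF_bound (𝔪 n) μ (Yn n)] with ω h1
    have h2 := scriptF_bound μ X (Xn n ω)
    simp only [hA, hB, Pi.sub_apply]
    generalize condScriptF μ (𝔪 n) (Xn n) ω = a at *
    generalize condScriptF μ (𝔪 n) (Yn n) ω = b at *
    generalize scriptF μ X (Xn n ω) = a' at *
    generalize scriptF μ Y (Yn n ω) = b' at *
    have h3 : a * b - a' * b' = b * (a - a') + a' * (b - b') := by ring
    rw [h3]
    refine (abs_add_le _ _).trans ?_
    rw [abs_mul, abs_mul]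
    exact add_le_add (mul_le_mul_of_nonneg_right h1 (abs_nonneg _))
      (mul_le_mul_of_nonneg_right h2 (abs_nonneg _))
  have iD : Integrable (fun ω => |(μ[A - B | 𝔪 n]) ω|) μ := integrable_condExp.abs
  have iE : Integrable (fun ω => |(μ[B | 𝔪 n]) ω - c|) μ :=
    (integrable_condExp.sub (integrable_const c)).abs
  calc ∫ ω, |3 * (μ[A | 𝔪 n]) ω - 3 - spearman μ X Y| ∂μ
      ≤ ∫ ω, 3 * (|(μ[A - B | 𝔪 n]) ω| + |(μ[B | 𝔪 n]) ω - c|) ∂μ := by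
        refine integral_mono_of_nonneg (Eventually.of_forall fun _ => abs_nonneg _)
          ((iD.add iE).const_mul 3) ?_
        filter_upwards [hsub] with ω hω
        rw [hω, Pi.sub_apply]
        have h3 : 3 * (μ[A | 𝔪 n]) ω - 3 - spearman μ X Y =
            3 * (((μ[A | 𝔪 n]) ω - (μ[B | 𝔪 n]) ω) + ((μ[B | 𝔪 n]) ω - c)) := by
          rw [spearman, ← hc]; ring
        rw [h3, abs_mul, abs_of_pos (three_pos : (0:ℝ) < 3)]
        exact mul_le_mul_of_nonneg_left (abs_add_le _ _) three_pos.le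
    _ = 3 * (∫ ω, |(μ[A - B | 𝔪 n]) ω| ∂μ + ∫ ω, |(μ[B | 𝔪 n]) ω - c| ∂μ) := by
        rw [integral_const_mul, integral_add iD iE]
    _ ≤ _ := by
        refine mul_le_mul_of_nonneg_left ?_ three_pos.le
        exact add_le_add (e1.trans e2) le_rfl
end

section
/- Let (X_n)_{n∈ℕ}, (Y_n)_{n∈ℕ} be integer-valued random variables and (Z_n)_{n∈ℕ} random elements on a common probability space, and let X, Y be integer-valued random variables such that (X_n,Y_n) converges in distribution to (X,Y) conditioned on Z_n. Then, as n→∞, the random variables E[𝓗_{X_n,Y_n|Z_n}(X_n,Y_n) | σ(Z_n)] − 1 converge in probability to Kendall's tau τ(X,Y) = E[𝓗_{X,Y}(X,Y)] − 1. -/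
open MeasureTheory Filter

/-- Joint cdf `H_{X,Y}(k,l) = P(X ≤ k, Y ≤ l)`. -/
noncomputable def intJointCdf {Ω : Type*} [MeasurableSpace Ω] (μ : Measure Ω)
    (X Y : Ω → ℤ) (k l : ℤ) : ℝ :=
  (μ {ω | X ω ≤ k ∧ Y ω ≤ l}).toReal

/-- `𝓗_{X,Y}(k,l) = H(k,l) + H(k−1,l) + H(k,l−1) + H(k−1,l−1)`. -/
noncomputable def scriptH {Ω : Type*} [MeasurableSpace Ω] (μ : Measure Ω)
    (X Y : Ω → ℤ) (k l : ℤ) : ℝ :=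
  intJointCdf μ X Y k l + intJointCdf μ X Y (k - 1) l +
    intJointCdf μ X Y k (l - 1) + intJointCdf μ X Y (k - 1) (l - 1)

/-- Kendall's tau of an integer-valued pair: `τ(X,Y) = E[𝓗_{X,Y}(X,Y)] − 1`. -/
noncomputable def kendall {Ω : Type*} [MeasurableSpace Ω] (μ : Measure Ω)
    (X Y : Ω → ℤ) : ℝ :=
  ∫ ω, scriptH μ X Y (X ω) (Y ω) ∂μ - 1

/-- Conditional joint cdf `H_{X,Y|Z}(k,l)`: a version of `E[1{X ≤ k}1{Y ≤ l} | 𝔪]`. -/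
noncomputable def condIntJointCdf {Ω : Type*} [MeasurableSpace Ω] (μ : Measure Ω)
    (𝔪 : MeasurableSpace Ω) (X Y : Ω → ℤ) (k l : ℤ) : Ω → ℝ :=
  μ[(fun ω => if X ω ≤ k ∧ Y ω ≤ l then (1 : ℝ) else 0) | 𝔪]

/-- `𝓗_{X,Y|Z}(X,Y)(ω)`: the sum of the four evaluations
`H_{X,Y|Z}(X(ω)−i, Y(ω)−j)(ω)` for `i,j ∈ {0,1}`. -/
noncomputable def condScriptH {Ω : Type*} [𝔪₀ : MeasurableSpace Ω] (μ : Measure Ω)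
    (𝔪 : MeasurableSpace Ω) (X Y : Ω → ℤ) : Ω → ℝ := fun ω =>
  @condIntJointCdf Ω 𝔪₀ μ 𝔪 X Y (X ω) (Y ω) ω +
    @condIntJointCdf Ω 𝔪₀ μ 𝔪 X Y (X ω - 1) (Y ω) ω +
    @condIntJointCdf Ω 𝔪₀ μ 𝔪 X Y (X ω) (Y ω - 1) ω +
    @condIntJointCdf Ω 𝔪₀ μ 𝔪 X Y (X ω - 1) (Y ω - 1) ω

/-- Indicator of a set of integer pairs, evaluated along `W`. -/
noncomputable def indW {Ω : Type*} (W : Ω → ℤ × ℤ) (S : Set (ℤ × ℤ)) : Ω → ℝ :=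
  fun ω => S.indicator (fun _ => (1 : ℝ)) (W ω)

/-- Conditional probability that `W` lies in `S`. -/
noncomputable def ceW {Ω : Type*} [𝔪₀ : MeasurableSpace Ω] (μ : Measure Ω)
    (m : MeasurableSpace Ω) (W : Ω → ℤ × ℤ) (S : Set (ℤ × ℤ)) : Ω → ℝ :=
  μ[indW W S | m]

/-- Conditional cdf evaluated at `W - d`. -/
noncomputable def evW {Ω : Type*} [𝔪₀ : MeasurableSpace Ω] (μ : Measure Ω)
    (m : MeasurableSpace Ω) (W : Ω → ℤ × ℤ) (d : ℤ × ℤ) : Ω → ℝ :=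
  fun ω => @ceW Ω 𝔪₀ μ m W (Set.Iic (W ω - d)) ω

lemma indW_nonneg {Ω : Type*} (W : Ω → ℤ × ℤ) (S : Set (ℤ × ℤ)) (ω : Ω) : 0 ≤ indW W S ω := by
  unfold indW
  exact Set.indicator_nonneg (fun _ _ => zero_le_one) _

lemma indW_le_one {Ω : Type*} (W : Ω → ℤ × ℤ) (S : Set (ℤ × ℤ)) (ω : Ω) : indW W S ω ≤ 1 := by
  unfold indW
  exact Set.indicator_le_self' (fun _ _ => zero_le_one) _

section
variable {Ω : Type*} {m : MeasurableSpace Ω} [𝔪₀ : MeasurableSpace Ω] {μ : Measure Ω} [IsProbabilityMeasure μ]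

lemma measurable_indW {W : Ω → ℤ × ℤ} (hW : Measurable W) (S : Set (ℤ × ℤ)) :
    Measurable (indW W S) :=
  (measurable_of_countable (S.indicator (fun _ => (1 : ℝ)))).comp hW

lemma integrable_indW {W : Ω → ℤ × ℤ} (hW : Measurable W) (S : Set (ℤ × ℤ)) :
    Integrable (indW W S) μ := by
  refine Integrable.of_bound (measurable_indW hW S).aestronglyMeasurable 1 (ae_of_all _ fun ω => ?_)
  rw [Real.norm_of_nonneg (indW_nonneg W S ω)]
  exact indW_le_one W S ω

lemma ceW_bounds (hm : m ≤ 𝔪₀) {W : Ω → ℤ × ℤ} (hW : Measurable W)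
    (S : Set (ℤ × ℤ)) : ∀ᵐ ω ∂μ, 0 ≤ ceW μ m W S ω ∧ ceW μ m W S ω ≤ 1 := by
  have h1 : 0 ≤ᵐ[μ] μ[indW W S | m] := condExp_nonneg (ae_of_all _ (indW_nonneg W S))
  have h2 : μ[indW W S | m] ≤ᵐ[μ] μ[(fun _ => (1 : ℝ)) | m] :=
    condExp_mono (integrable_indW hW S) (integrable_const _) (ae_of_all _ (indW_le_one W S))
  rw [condExp_const hm] at h2
  filter_upwards [h1, h2] with ω a b
  exact ⟨a, b⟩

lemma ceW_sm (W : Ω → ℤ × ℤ)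
    (S : Set (ℤ × ℤ)) : StronglyMeasurable[m] (ceW μ m W S) :=
  stronglyMeasurable_condExp

lemma measurable_evW (hm : m ≤ 𝔪₀) {W : Ω → ℤ × ℤ} (hW : Measurable W)
    (d : ℤ × ℤ) : Measurable (evW μ m W d) := by
  have : Measurable (fun p : Ω × (ℤ × ℤ) => ceW μ m W (Set.Iic (p.2 - d)) p.1) :=
    measurable_from_prod_countable_left fun y =>
      ((ceW_sm (μ := μ) W (Set.Iic (y - d))).mono hm).measurable
  exact this.comp (measurable_id.prodMk hW)

lemma evW_bounds (hm : m ≤ 𝔪₀) {W : Ω → ℤ × ℤ} (hW : Measurable W)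
    (d : ℤ × ℤ) : ∀ᵐ ω ∂μ, 0 ≤ evW μ m W d ω ∧ evW μ m W d ω ≤ 1 := by
  have : ∀ᵐ ω ∂μ, ∀ q : ℤ × ℤ, 0 ≤ ceW μ m W (Set.Iic q) ω ∧ ceW μ m W (Set.Iic q) ω ≤ 1 :=
    ae_all_iff.2 fun q => ceW_bounds hm hW _
  filter_upwards [this] with ω h
  exact h _

lemma integrable_evW (hm : m ≤ 𝔪₀) {W : Ω → ℤ × ℤ} (hW : Measurable W)
    (d : ℤ × ℤ) : Integrable (evW μ m W d) μ := by
  refine Integrable.of_bound (measurable_evW hm hW d).aestronglyMeasurable 1 ?_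
  filter_upwards [evW_bounds hm hW d] with ω h
  rw [Real.norm_of_nonneg h.1]
  exact h.2

lemma key_bound (hm : m ≤ 𝔪₀) {W : Ω → ℤ × ℤ} (hW : Measurable W)
    (d : ℤ × ℤ) (F : Finset (ℤ × ℤ)) :
    ∀ᵐ ω ∂μ, |(μ[evW μ m W d | m]) ω -
      ∑ q ∈ F, ceW μ m W {q} ω * ceW μ m W (Set.Iic (q - d)) ω| ≤
        ceW μ m W ((F : Set (ℤ × ℤ))ᶜ) ω := by
  set T : ℤ × ℤ → Ω → ℝ := fun q => indW W {q} * ceW μ m W (Set.Iic (q - d)) with hT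
  have hTi : ∀ q, Integrable (T q) μ := by
    intro q
    refine Integrable.of_bound ((measurable_indW hW _).mul
      ((ceW_sm W _).mono hm).measurable).aestronglyMeasurable 1 ?_
    filter_upwards [ceW_bounds (μ := μ) hm hW (Set.Iic (q - d))] with ω h
    simp only [hT]
    rw [Pi.mul_apply, norm_mul, Real.norm_of_nonneg (indW_nonneg _ _ _), Real.norm_of_nonneg h.1]
    exact mul_le_one₀ (indW_le_one _ _ _) h.1 h.2
  have hTs : Integrable (∑ q ∈ F, T q) μ := integrable_finsetSum' _ fun q _ => hTi q
  have hE := integrable_evW (μ := μ) hm hW d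
  have h1 := condExp_sub hE hTs m
  have h2 := condExp_finsetSum (s := F) (fun q _ => hTi q) m
  have h3 : ∀ᵐ ω ∂μ, ∀ q, (μ[T q | m]) ω = ceW μ m W {q} ω * ceW μ m W (Set.Iic (q - d)) ω :=
    ae_all_iff.2 fun q =>
      condExp_mul_of_stronglyMeasurable_right (ceW_sm W _) (hTi q) (integrable_indW hW _)
  have h4 := abs_condExp_ae_le_condExp_abs (μ := μ) (m := m) (evW μ m W d - ∑ q ∈ F, T q)
  have h5 : |evW μ m W d - ∑ q ∈ F, T q| ≤ᵐ[μ] indW W ((F : Set (ℤ × ℤ))ᶜ) := by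
    filter_upwards [evW_bounds (μ := μ) hm hW d] with ω h
    have hsum : (∑ q ∈ F, T q) ω = if W ω ∈ F then evW μ m W d ω else 0 := by
      rw [Finset.sum_apply]
      have : ∀ q ∈ F, T q ω = if W ω = q then evW μ m W d ω else 0 := by
        intro q _
        by_cases hq : W ω = q
        · simp [hT, indW, evW, hq]
        · simp [hT, indW, hq]
      rw [Finset.sum_congr rfl this, Finset.sum_ite_eq]
    rw [Pi.abs_apply, Pi.sub_apply, hsum]
    by_cases hF : W ω ∈ F
    · simp [hF, indW]
    · simp only [hF, if_false, sub_zero, indW]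
      rw [abs_of_nonneg h.1]
      simpa [hF] using h.2
  have h6 := condExp_mono (m := m) (hE.sub hTs).abs (integrable_indW (μ := μ) hW _) h5
  filter_upwards [h1, h2, h3, h4, h6] with ω a1 a2 a3 a4 a6
  have : (μ[evW μ m W d | m]) ω -
      ∑ q ∈ F, ceW μ m W {q} ω * ceW μ m W (Set.Iic (q - d)) ω =
      (μ[evW μ m W d - ∑ q ∈ F, T q | m]) ω := by
    rw [a1, Pi.sub_apply, a2, Finset.sum_apply]
    simp only [a3]
  rw [this]
  exact a4.trans a6

lemma tim_of_family {ι : Type*} {f : ι → ℕ → Ω → ℝ} {c : ι → ℝ}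
    (hf : ∀ i, TendstoInMeasure μ (f i) atTop (fun _ => c i)) {g : ℕ → Ω → ℝ} {t : ℝ}
    (h : ∀ ε > 0, ∃ s : Finset ι, ∃ δ > 0, ∀ n, ∀ᵐ ω ∂μ,
      (∀ i ∈ s, |f i n ω - c i| < δ) → |g n ω - t| < ε) :
    TendstoInMeasure μ g atTop (fun _ => t) := by
  rw [tendstoInMeasure_iff_dist]
  intro ε hε
  obtain ⟨s, δ, hδ, H⟩ := h ε hε
  have h0 : Tendsto (fun n => ∑ i ∈ s, μ {x | δ ≤ dist (f i n x) (c i)}) atTop (nhds 0) := by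
    have := tendsto_finsetSum s fun i _ => (tendstoInMeasure_iff_dist.1 (hf i)) δ hδ
    simpa using this
  refine tendsto_of_tendsto_of_tendsto_of_le_of_le tendsto_const_nhds h0 (fun _ => zero_le) ?_
  intro n
  refine le_trans (measure_mono_ae ?_) (measure_biUnion_finset_le s _)
  filter_upwards [H n] with ω hω
  intro hmem
  by_contra hcon
  have : ∀ i ∈ s, |f i n ω - c i| < δ := by
    intro i hi
    by_contra hlt
    exact hcon (Set.mem_biUnion hi (by simpa [Real.dist_eq] using hlt))
  have h2 := hω this
  have h3 : ε ≤ dist (g n ω) t := hmem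
  rw [Real.dist_eq] at h3
  linarith

lemma exists_bcf (S : Set (ℤ × ℤ)) : ∃ h : BoundedContinuousFunction (ℝ × ℝ) ℝ,
    ∀ a b : ℤ, h ((a : ℝ), (b : ℝ)) = S.indicator (fun _ => (1 : ℝ)) (a, b) := by
  have he : Topology.IsClosedEmbedding (Prod.map ((↑) : ℤ → ℝ) ((↑) : ℤ → ℝ)) :=
    Int.isClosedEmbedding_coe_real.prodMap Int.isClosedEmbedding_coe_real
  let f : BoundedContinuousFunction (ℤ × ℤ) ℝ :=
    BoundedContinuousFunction.ofNormedAddCommGroupDiscrete (S.indicator (fun _ => (1 : ℝ))) 1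
      (fun x => by by_cases hx : x ∈ S <;> simp [hx])
  obtain ⟨g, -, hg⟩ := BoundedContinuousFunction.exists_extension_norm_eq_of_isClosedEmbedding f he
  exact ⟨g, fun a b => congrFun hg (a, b)⟩

lemma exists_tail {W : Ω → ℤ × ℤ} (hW : Measurable W) {ε : ℝ} (hε : 0 < ε) :
    ∃ F : Finset (ℤ × ℤ), ∫ ω, indW W ((F : Set (ℤ × ℤ))ᶜ) ω ∂μ < ε := by
  have h := tendsto_measure_iInter_atTop (μ := μ)
    (s := fun F : Finset (ℤ × ℤ) => W ⁻¹' ((F : Set (ℤ × ℤ))ᶜ))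
    (fun F => (hW (Set.to_countable _).measurableSet).nullMeasurableSet)
    (fun F G hFG => Set.preimage_mono (Set.compl_subset_compl.2 (Finset.coe_subset.2 hFG)))
    ⟨∅, measure_ne_top _ _⟩
  have hI : (⋂ F : Finset (ℤ × ℤ), W ⁻¹' ((F : Set (ℤ × ℤ))ᶜ)) = ∅ := by
    ext ω
    simp only [Set.mem_iInter, Set.mem_preimage, Set.mem_compl_iff, Set.mem_empty_iff_false,
      iff_false, not_forall, not_not]
    exact ⟨{W ω}, by simp⟩
  rw [hI, measure_empty] at h
  obtain ⟨F, hF⟩ := (h.eventually (gt_mem_nhds (ENNReal.ofReal_pos.2 hε))).exists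
  refine ⟨F, ?_⟩
  have : indW W ((F : Set (ℤ × ℤ))ᶜ) = (W ⁻¹' ((F : Set (ℤ × ℤ))ᶜ)).indicator 1 := by
    ext ω; by_cases hh : W ω ∈ F <;> simp [indW, hh]
  rw [this, integral_indicator_one (hW (Set.to_countable _).measurableSet)]
  exact (ENNReal.lt_ofReal_iff_toReal_lt (measure_ne_top _ _)).1 hF

lemma conv_ev {W : Ω → ℤ × ℤ} (hW : Measurable W) {Wn : ℕ → Ω → ℤ × ℤ}
    (hWn : ∀ n, Measurable (Wn n)) {𝔪 : ℕ → MeasurableSpace Ω} (h𝔪 : ∀ n, 𝔪 n ≤ 𝔪₀)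
    (hc : ∀ S, TendstoInMeasure μ (fun n => ceW μ (𝔪 n) (Wn n) S) atTop
      (fun _ => ∫ ω, indW W S ω ∂μ)) (d : ℤ × ℤ) :
    TendstoInMeasure μ (fun n => μ[evW μ (𝔪 n) (Wn n) d | 𝔪 n]) atTop
      (fun _ => ∫ ω, evW μ ⊥ W d ω ∂μ) := by
  refine tim_of_family hc ?_
  intro ε hε
  obtain ⟨F, hF⟩ := exists_tail (μ := μ) hW (show 0 < ε / 8 by positivity)
  have hdet : |∫ ω, evW μ ⊥ W d ω ∂μ -
      ∑ q ∈ F, (∫ ω, indW W {q} ω ∂μ) * (∫ ω, indW W (Set.Iic (q - d)) ω ∂μ)| ≤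
      ∫ ω, indW W ((F : Set (ℤ × ℤ))ᶜ) ω ∂μ := by
    obtain ⟨ω, hω⟩ := (key_bound (μ := μ) bot_le hW d F).exists
    simpa only [ceW, condExp_bot] using hω
  set A : ℝ := ∑ q ∈ F, (∫ ω, indW W {q} ω ∂μ) * (∫ ω, indW W (Set.Iic (q - d)) ω ∂μ) with hA
  -- continuity of the finite sum of products
  have hcont : Continuous (fun u : Set (ℤ × ℤ) → ℝ =>
      ∑ q ∈ F, u {q} * u (Set.Iic (q - d))) := by fun_prop
  classical
  have hprod : ∃ δ > 0, ∀ u : Set (ℤ × ℤ) → ℝ,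
      (∀ q ∈ F, |u {q} - ∫ ω, indW W {q} ω ∂μ| < δ ∧
        |u (Set.Iic (q - d)) - ∫ ω, indW W (Set.Iic (q - d)) ω ∂μ| < δ) →
      |∑ q ∈ F, u {q} * u (Set.Iic (q - d)) - A| < ε / 4 := by
    let Φ : (F → ℝ × ℝ) → ℝ := fun v => ∑ q, (v q).1 * (v q).2
    have hΦ : Continuous Φ := by fun_prop
    let v₀ : F → ℝ × ℝ := fun q => (∫ ω, indW W {q.1} ω ∂μ, ∫ ω, indW W (Set.Iic (q.1 - d)) ω ∂μ)
    obtain ⟨δ, hδ, H⟩ := Metric.continuous_iff.1 hΦ v₀ (ε / 4) (by positivity)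
    refine ⟨δ, hδ, fun u hu => ?_⟩
    have := H (fun q => (u {q.1}, u (Set.Iic (q.1 - d)))) (by
      rw [dist_pi_lt_iff hδ]
      intro q
      rw [Prod.dist_eq, max_lt_iff, Real.dist_eq, Real.dist_eq]
      exact hu q.1 q.2)
    rw [Real.dist_eq] at this
    have e1 : Φ (fun q => (u {q.1}, u (Set.Iic (q.1 - d)))) =
        ∑ q ∈ F, u {q} * u (Set.Iic (q - d)) :=
      Finset.sum_coe_sort F (fun q => u {q} * u (Set.Iic (q - d)))
    have e2 : Φ v₀ = A :=
      Finset.sum_coe_sort F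
        (fun q => (∫ ω, indW W {q} ω ∂μ) * (∫ ω, indW W (Set.Iic (q - d)) ω ∂μ))
    rwa [e1, e2] at this
  obtain ⟨δ, hδ, hprod⟩ := hprod
  refine ⟨insert ((F : Set (ℤ × ℤ))ᶜ)
    (F.image (fun q => ({q} : Set (ℤ × ℤ))) ∪ F.image (fun q => Set.Iic (q - d))),
    min δ (ε / 4), by positivity, fun n => ?_⟩
  filter_upwards [key_bound (μ := μ) (h𝔪 n) (hWn n) d F] with ω hω hs
  have h1 := hprod (fun S => ceW μ (𝔪 n) (Wn n) S ω) (fun q hq =>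
    ⟨(hs _ (Finset.mem_insert_of_mem (Finset.mem_union_left _
        (Finset.mem_image_of_mem _ hq)))).trans_le (min_le_left _ _),
     (hs _ (Finset.mem_insert_of_mem (Finset.mem_union_right _
        (Finset.mem_image_of_mem (fun q => Set.Iic (q - d)) hq)))).trans_le (min_le_left _ _)⟩)
  have h2 := (hs _ (Finset.mem_insert_self _ _)).trans_le (min_le_right _ _)
  rw [abs_lt] at h1 h2 ⊢
  rw [abs_le] at hω hdet
  constructor <;> linarith [hω.1, hω.2, hdet.1, hdet.2, h1.1, h1.2, h2.1, h2.2]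

lemma condIntJointCdf_eq (X Y : Ω → ℤ) (k l : ℤ) :
    condIntJointCdf μ m X Y k l = ceW μ m (fun ω => (X ω, Y ω)) (Set.Iic (k, l)) := by
  unfold condIntJointCdf ceW
  congr 1
  ext ω
  simp [indW, Set.indicator_apply]

lemma intJointCdf_eq {X Y : Ω → ℤ} (hX : Measurable X) (hY : Measurable Y) (k l : ℤ) (ω : Ω) :
    intJointCdf μ X Y k l = ceW μ ⊥ (fun ω => (X ω, Y ω)) (Set.Iic (k, l)) ω := by
  unfold intJointCdf ceW
  rw [condExp_bot]
  have hm : MeasurableSet {ω | X ω ≤ k ∧ Y ω ≤ l} :=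
    (measurableSet_le hX measurable_const).inter (measurableSet_le hY measurable_const)
  have : indW (fun ω => (X ω, Y ω)) (Set.Iic (k, l)) = {ω | X ω ≤ k ∧ Y ω ≤ l}.indicator 1 := by
    ext ω
    simp [indW, Set.indicator_apply]
  rw [this, integral_indicator_one hm]
  rfl

end

/-- If `(X_n, Y_n)` converges in distribution to `(X, Y)` conditioned on
`Z_n` (represented by the sub-σ-algebras `𝔪 n = σ(Z_n)`), then
`E[𝓗_{X_n,Y_n|Z_n}(X_n,Y_n) | σ(Z_n)] − 1` converges in probability to
Kendall's tau `τ(X,Y) = E[𝓗_{X,Y}(X,Y)] − 1`. -/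
theorem kendall_consistency {Ω : Type*} [MeasurableSpace Ω] (μ : Measure Ω)
    [IsProbabilityMeasure μ]
    (X Y : Ω → ℤ) (Xn Yn : ℕ → Ω → ℤ) (𝔪 : ℕ → MeasurableSpace Ω)
    (h𝔪 : ∀ n, 𝔪 n ≤ ‹MeasurableSpace Ω›)
    (hX : Measurable X) (hY : Measurable Y)
    (hXn : ∀ n, Measurable (Xn n)) (hYn : ∀ n, Measurable (Yn n))
    (hconv : ∀ h : BoundedContinuousFunction (ℝ × ℝ) ℝ,
      TendstoInMeasure μ
        (fun n => μ[(fun ω => h ((Xn n ω : ℝ), (Yn n ω : ℝ))) | 𝔪 n]) atTop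
        (fun _ => ∫ ω, h ((X ω : ℝ), (Y ω : ℝ)) ∂μ)) :
    TendstoInMeasure μ
      (fun n ω =>
        (μ[(fun ω' => condScriptH μ (𝔪 n) (Xn n) (Yn n) ω') | 𝔪 n]) ω - 1)
      atTop (fun _ => kendall μ X Y) := by
  set W : Ω → ℤ × ℤ := fun ω => (X ω, Y ω) with hWdef
  set Wn : ℕ → Ω → ℤ × ℤ := fun n ω => (Xn n ω, Yn n ω) with hWndef
  have hW : Measurable W := hX.prodMk hY
  have hWn : ∀ n, Measurable (Wn n) := fun n => (hXn n).prodMk (hYn n)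
  have hc : ∀ S, TendstoInMeasure μ (fun n => ceW μ (𝔪 n) (Wn n) S) atTop
      (fun _ => ∫ ω, indW W S ω ∂μ) := by
    intro S
    obtain ⟨h, hh⟩ := exists_bcf S
    have := hconv h
    simp only [hh] at this
    exact this
  have hd := fun d => conv_ev (μ := μ) hW hWn h𝔪 hc d
  refine tim_of_family hd ?_
  intro ε hε
  refine ⟨{(0, 0), (1, 0), (0, 1), (1, 1)}, ε / 4, by positivity, fun n => ?_⟩
  have hi := fun d => integrable_evW (μ := μ) (h𝔪 n) (hWn n) d
  have hG : (fun ω' => condScriptH μ (𝔪 n) (Xn n) (Yn n) ω') =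
      evW μ (𝔪 n) (Wn n) (0, 0) + evW μ (𝔪 n) (Wn n) (1, 0) + evW μ (𝔪 n) (Wn n) (0, 1) +
        evW μ (𝔪 n) (Wn n) (1, 1) := by
    ext ω
    simp [condScriptH, condIntJointCdf_eq, evW, hWndef]
  have hK : kendall μ X Y = ∫ ω, evW μ ⊥ W (0, 0) ω ∂μ + ∫ ω, evW μ ⊥ W (1, 0) ω ∂μ +
      ∫ ω, evW μ ⊥ W (0, 1) ω ∂μ + ∫ ω, evW μ ⊥ W (1, 1) ω ∂μ - 1 := by
    have hi' := fun d => integrable_evW (μ := μ) bot_le hW d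
    have e1 := integral_add (hi' (0, 0)) (hi' (1, 0))
    have e2 := integral_add ((hi' (0, 0)).add (hi' (1, 0))) (hi' (0, 1))
    have e3 := integral_add (((hi' (0, 0)).add (hi' (1, 0))).add (hi' (0, 1))) (hi' (1, 1))
    simp only [Pi.add_apply] at e1 e2 e3
    rw [← e1, ← e2, ← e3]
    unfold kendall
    congr 1
    refine integral_congr_ae (ae_of_all _ fun ω => ?_)
    simp [scriptH, intJointCdf_eq hX hY _ _ ω, evW, hWdef]
  rw [hG, hK]
  filter_upwards [condExp_add (((hi (0, 0)).add (hi (1, 0))).add (hi (0, 1))) (hi (1, 1)) (𝔪 n),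
    condExp_add ((hi (0, 0)).add (hi (1, 0))) (hi (0, 1)) (𝔪 n),
    condExp_add (hi (0, 0)) (hi (1, 0)) (𝔪 n)] with ω a1 a2 a3 hs
  rw [a1, Pi.add_apply, a2, Pi.add_apply, a3, Pi.add_apply]
  have b1 := abs_lt.1 (hs (0, 0) (by simp))
  have b2 := abs_lt.1 (hs (1, 0) (by simp))
  have b3 := abs_lt.1 (hs (0, 1) (by simp))
  have b4 := abs_lt.1 (hs (1, 1) (by simp))
  rw [abs_lt]
  constructor <;> linarith [b1.1, b1.2, b2.1, b2.2, b3.1, b3.2, b4.1, b4.2]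
end

section
/- Let (X_n)_{n∈ℕ}, (Y_n)_{n∈ℕ} be integer-valued random variables and (Z_n)_{n∈ℕ} random elements on a common probability space, and let X, Y be integer-valued random variables such that (X_n,Y_n) converges in distribution to (X,Y) conditioned on Z_n. Then the expectations converge: lim_{n→∞} 3·E[𝓕_{X_n|Z_n}(X_n)·𝓕_{Y_n|Z_n}(Y_n)] − 3 = ρ(X,Y) and lim_{n→∞} E[𝓗_{X_n,Y_n|Z_n}(X_n,Y_n)] − 1 = τ(X,Y). -/
open MeasureTheory Filter

/-- Bounded convergence in measure gives `L¹` convergence to a constant. -/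
theorem aux_L1 {Ω : Type*} [MeasurableSpace Ω] (μ : Measure Ω) [IsProbabilityMeasure μ]
    (f : ℕ → Ω → ℝ) (c C : ℝ) (hf : ∀ n, Measurable (f n))
    (hb : ∀ n, ∀ᵐ ω ∂μ, |f n ω| ≤ C) (hc : |c| ≤ C)
    (h : TendstoInMeasure μ f atTop (fun _ => c)) :
    Tendsto (fun n => ∫ ω, |f n ω - c| ∂μ) atTop (nhds 0) := by
  have hC : 0 ≤ C := (abs_nonneg c).trans hc
  rw [Metric.tendsto_atTop]
  intro ε hε
  have h1 := h (ENNReal.ofReal (ε / 2)) (by positivity)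
  have h2 : Tendsto (fun n => μ.real {x | ENNReal.ofReal (ε / 2) ≤ edist (f n x) c})
      atTop (nhds 0) := by
    have := (ENNReal.tendsto_toReal ENNReal.zero_ne_top).comp h1
    simpa [Measure.real, Function.comp_def] using this
  have h3 : Tendsto (fun n => ε / 2 + 2 * C * μ.real {x | ENNReal.ofReal (ε / 2) ≤ edist (f n x) c})
      atTop (nhds (ε / 2 + 2 * C * 0)) := (h2.const_mul _).const_add _
  have h4 := h3.eventually (gt_mem_nhds (show ε / 2 + 2 * C * 0 < ε by linarith))
  obtain ⟨N, hN⟩ := eventually_atTop.1 h4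
  refine ⟨N, fun n hn => ?_⟩
  have hn' := hN n hn
  have hms : MeasurableSet {x | ENNReal.ofReal (ε / 2) ≤ edist (f n x) c} :=
    measurableSet_le measurable_const ((hf n).edist measurable_const)
  rw [Real.dist_eq, sub_zero, abs_of_nonneg (integral_nonneg fun ω => abs_nonneg _)]
  refine lt_of_le_of_lt ?_ hn'
  have : ε / 2 + 2 * C * μ.real {x | ENNReal.ofReal (ε / 2) ≤ edist (f n x) c}
      = ∫ ω, (ε / 2 + ({x | ENNReal.ofReal (ε / 2) ≤ edist (f n x) c}).indicator
        (fun _ => 2 * C) ω) ∂μ := by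
    rw [integral_add (integrable_const _) ((integrable_const _).indicator hms),
      integral_indicator_const _ hms]
    simp [mul_comm]
  rw [this]
  refine integral_mono_of_nonneg (ae_of_all _ fun ω => abs_nonneg _)
    ((integrable_const _).add ((integrable_const _).indicator hms)) ?_
  filter_upwards [hb n] with ω hω
  by_cases hm : ω ∈ {x | ENNReal.ofReal (ε / 2) ≤ edist (f n x) c}
  · rw [Set.indicator_of_mem hm]
    have := abs_sub (f n ω) c
    linarith
  · rw [Set.indicator_of_notMem hm]
    simp only [Set.mem_setOf_eq, not_le, edist_dist] at hm
    have := (ENNReal.ofReal_lt_ofReal_iff (by positivity)).1 hm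
    rw [Real.dist_eq] at this
    linarith

theorem aux_meas {Ω : Type*} [MeasurableSpace Ω] (B : ℤ × ℤ → Ω → ℝ) (W : Ω → ℤ × ℤ)
    (hB : ∀ p, Measurable (B p)) (hW : Measurable W) : Measurable fun ω => B (W ω) ω := by
  have : Measurable (fun q : (ℤ × ℤ) × Ω => B q.1 q.2) :=
    measurable_from_prod_countable_right hB
  exact this.comp (hW.prodMk measurable_id)

theorem aux_ite_meas {Ω : Type*} [MeasurableSpace Ω] (W : Ω → ℤ × ℤ) (hW : Measurable W)
    (p : ℤ × ℤ) : Measurable (fun ω => if W ω = p then (1 : ℝ) else 0) :=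
  Measurable.ite (hW (measurableSet_singleton p)) measurable_const measurable_const

theorem aux_int {Ω : Type*} [MeasurableSpace Ω] (μ : Measure Ω) [IsProbabilityMeasure μ]
    {f : Ω → ℝ} (hf : Measurable f) {C : ℝ} (h : ∀ᵐ ω ∂μ, |f ω| ≤ C) : Integrable f μ :=
  Integrable.of_bound hf.aestronglyMeasurable C h

theorem aux_trunc {Ω : Type*} [MeasurableSpace Ω] (μ : Measure Ω) [IsProbabilityMeasure μ]
    (B : ℤ × ℤ → Ω → ℝ) (W : Ω → ℤ × ℤ) (C : ℝ) (hC : 0 ≤ C)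
    (hB : ∀ p, Measurable (B p)) (hW : Measurable W)
    (hb : ∀ p, ∀ᵐ ω ∂μ, |B p ω| ≤ C) (S : Finset (ℤ × ℤ)) :
    |∫ ω, B (W ω) ω ∂μ - ∑ p ∈ S, ∫ ω, B p ω * (if W ω = p then (1 : ℝ) else 0) ∂μ|
      ≤ C * (1 - ∑ p ∈ S, ∫ ω, (if W ω = p then (1 : ℝ) else 0) ∂μ) := by
  have hall : ∀ᵐ ω ∂μ, ∀ p, |B p ω| ≤ C := ae_all_iff.2 hb
  have i0 : ∀ p, Integrable (fun ω => if W ω = p then (1 : ℝ) else 0) μ := fun p =>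
    aux_int μ (aux_ite_meas W hW p) (C := 1) (ae_of_all _ fun ω => by split_ifs <;> simp)
  have i1 : ∀ p, Integrable (fun ω => B p ω * (if W ω = p then (1 : ℝ) else 0)) μ := fun p =>
    aux_int μ ((hB p).mul (aux_ite_meas W hW p)) (C := C) (by
      filter_upwards [hb p] with ω hω
      split_ifs <;> simp [hω, hC])
  have i2 : Integrable (fun ω => B (W ω) ω) μ :=
    aux_int μ (aux_meas B W hB hW) (C := C) (by
      filter_upwards [hall] with ω hω using hω _)
  have e1 : C * (1 - ∑ p ∈ S, ∫ ω, (if W ω = p then (1 : ℝ) else 0) ∂μ)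
      = ∫ ω, C * (1 - ∑ p ∈ S, (if W ω = p then (1 : ℝ) else 0)) ∂μ := by
    rw [integral_const_mul, integral_sub (integrable_const _)
      (integrable_finsetSum _ fun p _ => i0 p), integral_finsetSum _ fun p _ => i0 p]
    simp
  rw [e1, ← integral_finsetSum _ fun p _ => i1 p,
    ← integral_sub i2 (integrable_finsetSum _ fun p _ => i1 p)]
  refine abs_integral_le_integral_abs.trans ?_
  refine integral_mono_of_nonneg (ae_of_all _ fun ω => abs_nonneg _)
    (((integrable_const _).sub (integrable_finsetSum _ fun p _ => i0 p)).const_mul _) ?_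
  filter_upwards [hall] with ω hω
  have := hω (W ω)
  simp only [mul_ite, mul_one, mul_zero, Finset.sum_ite_eq]
  split_ifs <;> simp [this]

theorem aux_tail {Ω : Type*} [MeasurableSpace Ω] (μ : Measure Ω) [IsProbabilityMeasure μ]
    (W : Ω → ℤ × ℤ) (hW : Measurable W) :
    Tendsto (fun S : Finset (ℤ × ℤ) => ∑ p ∈ S, ∫ ω, (if W ω = p then (1 : ℝ) else 0) ∂μ)
      atTop (nhds 1) := by
  have i0 : ∀ p, Integrable (fun ω => if W ω = p then (1 : ℝ) else 0) μ := fun p =>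
    aux_int μ (aux_ite_meas W hW p) (C := 1) (ae_of_all _ fun ω => by split_ifs <;> simp)
  have : Tendsto (fun S : Finset (ℤ × ℤ) => ∫ ω, ∑ p ∈ S, (if W ω = p then (1 : ℝ) else 0) ∂μ)
      atTop (nhds (∫ ω, (1 : ℝ) ∂μ)) := by
    refine tendsto_integral_filter_of_dominated_convergence (fun _ => 1) ?_ ?_
      (integrable_const _) ?_
    · exact Eventually.of_forall fun S =>
        (integrable_finsetSum _ fun p _ => i0 p).aestronglyMeasurable
    · refine Eventually.of_forall fun S => ae_of_all _ fun ω => ?_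
      simp only [Finset.sum_ite_eq]
      split_ifs <;> simp
    · refine ae_of_all _ fun ω => ?_
      refine tendsto_const_nhds.congr' ?_
      filter_upwards [eventually_ge_atTop {W ω}] with S hS
      have : W ω ∈ S := by simpa using hS
      simp [this]
  simp only [integral_const, probReal_univ, smul_eq_mul, mul_one] at this
  refine this.congr fun S => ?_
  rw [integral_finsetSum _ fun p _ => i0 p]

theorem aux_core {Ω : Type*} [MeasurableSpace Ω] (μ : Measure Ω) [IsProbabilityMeasure μ]
    (A : ℕ → ℤ × ℤ → Ω → ℝ) (a : ℤ × ℤ → ℝ) (W : ℕ → Ω → ℤ × ℤ) (V : Ω → ℤ × ℤ)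
    (C : ℝ) (hC : 0 ≤ C)
    (hA : ∀ n p, Measurable (A n p)) (hW : ∀ n, Measurable (W n)) (hV : Measurable V)
    (hb : ∀ n p, ∀ᵐ ω ∂μ, |A n p ω| ≤ C) (ha : ∀ p, |a p| ≤ C)
    (hL : ∀ p, Tendsto (fun n => ∫ ω, |A n p ω - a p| ∂μ) atTop (nhds 0))
    (hq : ∀ p, Tendsto (fun n => ∫ ω, (if W n ω = p then (1 : ℝ) else 0) ∂μ) atTop
      (nhds (∫ ω, (if V ω = p then (1 : ℝ) else 0) ∂μ))) :
    Tendsto (fun n => ∫ ω, A n (W n ω) ω ∂μ) atTop (nhds (∫ ω, a (V ω) ∂μ)) := by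
  have i0 : ∀ n p, Integrable (fun ω => if W n ω = p then (1 : ℝ) else 0) μ := fun n p =>
    aux_int μ (aux_ite_meas (W n) (hW n) p) (C := 1) (ae_of_all _ fun ω => by split_ifs <;> simp)
  have iA : ∀ n p, Integrable (A n p) μ := fun n p => aux_int μ (hA n p) (hb n p)
  have i1 : ∀ n p, Integrable (fun ω => A n p ω * (if W n ω = p then (1 : ℝ) else 0)) μ :=
    fun n p => aux_int μ ((hA n p).mul (aux_ite_meas (W n) (hW n) p)) (C := C) (by
      filter_upwards [hb n p] with ω hω
      split_ifs <;> simp [hω, hC])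
  -- termwise convergence
  have hterm : ∀ p, Tendsto
      (fun n => ∫ ω, A n p ω * (if W n ω = p then (1 : ℝ) else 0) ∂μ) atTop
      (nhds (∫ ω, a p * (if V ω = p then (1 : ℝ) else 0) ∂μ)) := by
    intro p
    rw [integral_const_mul]
    have h0 : Tendsto (fun n => ∫ ω, A n p ω * (if W n ω = p then (1 : ℝ) else 0) ∂μ
        - a p * ∫ ω, (if W n ω = p then (1 : ℝ) else 0) ∂μ) atTop (nhds 0) := by
      refine squeeze_zero_norm (fun n => ?_) (hL p)
      rw [← integral_const_mul, ← integral_sub (i1 n p) ((i0 n p).const_mul _)]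
      refine (norm_integral_le_integral_norm _).trans ?_
      refine integral_mono_of_nonneg (ae_of_all _ fun ω => norm_nonneg _)
        ((iA n p).sub (integrable_const _)).abs (ae_of_all _ fun ω => ?_)
      simp only [Real.norm_eq_abs]
      split_ifs <;> simp
    have := h0.add ((hq p).const_mul (a p))
    simpa using this
  rw [Metric.tendsto_atTop]
  intro ε hε
  have hδ : 0 < ε / (4 * (C + 1)) := by positivity
  obtain ⟨S, hS⟩ := ((aux_tail μ V hV).eventually
    (lt_mem_nhds (show 1 - ε / (4 * (C + 1)) < 1 by linarith))).exists
  have t1 := tendsto_finsetSum S (fun p _ => hterm p)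
  have t2 := tendsto_finsetSum S (fun p _ => hq p)
  have t3 := t2.eventually (lt_mem_nhds hS)
  have t4 := Metric.tendsto_nhds.1 t1 (ε / 4) (by positivity)
  obtain ⟨N, hN⟩ := eventually_atTop.1 (t3.and t4)
  refine ⟨N, fun n hn => ?_⟩
  obtain ⟨h3, h4⟩ := hN n hn
  have b1 := aux_trunc μ (A n) (W n) C hC (hA n) (hW n) (hb n) S
  have b2 := aux_trunc μ (fun p _ => a p) V C hC (fun p => measurable_const) hV
    (fun p => ae_of_all _ fun _ => ha p) S
  rw [Real.dist_eq] at h4 ⊢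
  have hCε : C * (ε / (4 * (C + 1))) ≤ ε / 4 := by
    have : C * (ε / (4 * (C + 1))) = ε / 4 * (C / (C + 1)) := by field_simp
    rw [this]
    have : C / (C + 1) ≤ 1 := by rw [div_le_one (by positivity)]; linarith
    nlinarith
  have c1 := b1.trans ((mul_le_mul_of_nonneg_left (by linarith) hC).trans hCε)
  have c2 := b2.trans ((mul_le_mul_of_nonneg_left (by linarith) hC).trans hCε)
  rw [abs_le] at c1 c2
  rw [abs_lt] at h4 ⊢
  constructor <;> linarith [c1.1, c1.2, c2.1, c2.2, h4.1, h4.2]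

/-- Conditional convergence for a bounded function, in `L¹`, for the conditional expectation of a
function `g` of the integer pair, given a continuous extension. -/
theorem aux_cond {Ω : Type*} [m0 : MeasurableSpace Ω]
    (μ : Measure Ω) [IsProbabilityMeasure μ]
    (X Y : Ω → ℤ) (Xn Yn : ℕ → Ω → ℤ) (𝔪 : ℕ → MeasurableSpace Ω)
    (h𝔪 : ∀ n, 𝔪 n ≤ m0)
    (hconv : ∀ h : BoundedContinuousFunction (ℝ × ℝ) ℝ,
      TendstoInMeasure μ
        (fun n => μ[(fun ω => h ((Xn n ω : ℝ), (Yn n ω : ℝ))) | 𝔪 n]) atTop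
        (fun _ => ∫ ω, h ((X ω : ℝ), (Y ω : ℝ)) ∂μ))
    (g : ℤ → ℤ → ℝ) (φ ψ : ℝ → ℝ) (hφ : Continuous φ) (hψ : Continuous ψ)
    (bφ : ∀ x, |φ x| ≤ 1) (bψ : ∀ x, |ψ x| ≤ 1)
    (hg : ∀ x y : ℤ, φ x * ψ y = g x y) :
    Tendsto (fun n => ∫ ω, |(μ[(fun ω => g (Xn n ω) (Yn n ω)) | 𝔪 n]) ω
      - ∫ ω, g (X ω) (Y ω) ∂μ| ∂μ) atTop (nhds 0) := by
  have bg : ∀ x y, |g x y| ≤ 1 := fun x y => by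
    rw [← hg, abs_mul]
    exact mul_le_one₀ (bφ _) (abs_nonneg _) (bψ _)
  let h : BoundedContinuousFunction (ℝ × ℝ) ℝ :=
    BoundedContinuousFunction.ofNormedAddCommGroup (fun q => φ q.1 * ψ q.2)
      (by fun_prop) 1 (fun q => by
        rw [Real.norm_eq_abs, abs_mul]
        exact mul_le_one₀ (bφ _) (abs_nonneg _) (bψ _))
  have hh := hconv h
  have e : ∀ x y : ℤ, h ((x : ℝ), (y : ℝ)) = g x y := fun x y => hg x y
  simp only [e] at hh
  refine aux_L1 μ _ _ 1 (fun n => (stronglyMeasurable_condExp.mono (h𝔪 n)).measurable) ?_ ?_ hh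
  · intro n
    have := ae_bdd_abs_condExp_of_ae_bdd_abs (m := 𝔪 n) (μ := μ) (R := (1 : ℝ))
      (f := fun ω => g (Xn n ω) (Yn n ω)) (ae_of_all _ fun ω => by simpa using bg _ _)
    simpa using this
  · have := norm_integral_le_of_norm_le_const (μ := μ) (f := fun ω => g (X ω) (Y ω)) (C := 1)
      (ae_of_all _ fun ω => bg _ _)
    simpa using this

noncomputable def auxClamp (k : ℤ) (x : ℝ) : ℝ := max 0 (min 1 ((k : ℝ) + 1 - x))
noncomputable def auxBump (k : ℤ) (x : ℝ) : ℝ := max 0 (1 - |x - k|)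

theorem auxClamp_cont (k : ℤ) : Continuous (auxClamp k) := by unfold auxClamp; fun_prop
theorem auxBump_cont (k : ℤ) : Continuous (auxBump k) := by unfold auxBump; fun_prop
theorem auxClamp_bd (k : ℤ) (x : ℝ) : |auxClamp k x| ≤ 1 := by
  unfold auxClamp
  rw [abs_of_nonneg (le_max_left _ _)]
  exact max_le (by norm_num) (min_le_left _ _)
theorem auxBump_bd (k : ℤ) (x : ℝ) : |auxBump k x| ≤ 1 := by
  unfold auxBump
  rw [abs_of_nonneg (le_max_left _ _)]
  exact max_le (by norm_num) (by linarith [abs_nonneg (x - k)])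
theorem auxClamp_int (k x : ℤ) : auxClamp k x = if x ≤ k then 1 else 0 := by
  unfold auxClamp
  split_ifs with h
  · have : (x : ℝ) ≤ k := by exact_mod_cast h
    rw [min_eq_left (by linarith), max_eq_right (by norm_num)]
  · have : (k : ℝ) + 1 ≤ x := by exact_mod_cast (by omega : k + 1 ≤ x)
    exact max_eq_left ((min_le_right _ _).trans (by linarith))
theorem auxBump_int (k x : ℤ) : auxBump k x = if x = k then 1 else 0 := by
  unfold auxBump
  split_ifs with h
  · simp [h]
  · have : (1 : ℝ) ≤ |(x : ℝ) - k| := by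
      exact_mod_cast Int.one_le_abs (sub_ne_zero.2 h)
    exact max_eq_left (by linarith)

theorem aux_L1_add {Ω : Type*} [MeasurableSpace Ω] (μ : Measure Ω) [IsProbabilityMeasure μ]
    (f g : ℕ → Ω → ℝ) (c d : ℝ) (hf : ∀ n, Integrable (f n) μ) (hg : ∀ n, Integrable (g n) μ)
    (h1 : Tendsto (fun n => ∫ ω, |f n ω - c| ∂μ) atTop (nhds 0))
    (h2 : Tendsto (fun n => ∫ ω, |g n ω - d| ∂μ) atTop (nhds 0)) :
    Tendsto (fun n => ∫ ω, |(f n ω + g n ω) - (c + d)| ∂μ) atTop (nhds 0) := by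
  have h := h1.add h2
  rw [add_zero] at h
  refine squeeze_zero (fun n => integral_nonneg fun ω => abs_nonneg _) (fun n => ?_) h
  have j1 := ((hf n).sub (integrable_const c)).abs
  have j2 := ((hg n).sub (integrable_const d)).abs
  refine le_trans ?_ (integral_add j1 j2).le
  refine integral_mono_of_nonneg (ae_of_all _ fun ω => abs_nonneg _) (j1.add j2)
    (ae_of_all _ fun ω => ?_)
  have := abs_add_le (f n ω - c) (g n ω - d)
  rwa [show f n ω - c + (g n ω - d) = (f n ω + g n ω) - (c + d) by ring] at this

theorem aux_L1_mul {Ω : Type*} [MeasurableSpace Ω] (μ : Measure Ω) [IsProbabilityMeasure μ]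
    (f g : ℕ → Ω → ℝ) (c d : ℝ) (hf : ∀ n, Integrable (f n) μ) (hg : ∀ n, Integrable (g n) μ)
    (bf : ∀ n, ∀ᵐ ω ∂μ, |f n ω| ≤ 2) (hd : |d| ≤ 2)
    (h1 : Tendsto (fun n => ∫ ω, |f n ω - c| ∂μ) atTop (nhds 0))
    (h2 : Tendsto (fun n => ∫ ω, |g n ω - d| ∂μ) atTop (nhds 0)) :
    Tendsto (fun n => ∫ ω, |(f n ω * g n ω) - (c * d)| ∂μ) atTop (nhds 0) := by
  have h := (h1.const_mul 2).add (h2.const_mul 2)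
  rw [mul_zero, add_zero] at h
  refine squeeze_zero (fun n => integral_nonneg fun ω => abs_nonneg _) (fun n => ?_) h
  have j1 := (((hf n).sub (integrable_const c)).abs).const_mul 2
  have j2 := (((hg n).sub (integrable_const d)).abs).const_mul 2
  rw [← integral_const_mul, ← integral_const_mul]
  refine le_trans ?_ (integral_add j1 j2).le
  refine integral_mono_of_nonneg (ae_of_all _ fun ω => abs_nonneg _) (j1.add j2) ?_
  filter_upwards [bf n] with ω hω
  have := abs_add_le (f n ω * (g n ω - d)) (d * (f n ω - c))
  rw [show f n ω * (g n ω - d) + d * (f n ω - c) = (f n ω * g n ω) - (c * d) by ring,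
    abs_mul, abs_mul] at this
  have k1 := mul_le_mul_of_nonneg_right hω (abs_nonneg (g n ω - d))
  have k2 := mul_le_mul_of_nonneg_right hd (abs_nonneg (f n ω - c))
  simp only [Pi.add_apply, Pi.sub_apply, ge_iff_le]
  linarith

/-- Under conditional convergence in distribution, the expectations
converge: `3·E[𝓕_{X_n|Z_n}(X_n)·𝓕_{Y_n|Z_n}(Y_n)] − 3 → ρ(X,Y)` and
`E[𝓗_{X_n,Y_n|Z_n}(X_n,Y_n)] − 1 → τ(X,Y)`. -/
theorem expectation_convergence_rank_correlations {Ω : Type*} [MeasurableSpace Ω]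
    (μ : Measure Ω) [IsProbabilityMeasure μ]
    (X Y : Ω → ℤ) (Xn Yn : ℕ → Ω → ℤ) (𝔪 : ℕ → MeasurableSpace Ω)
    (h𝔪 : ∀ n, 𝔪 n ≤ ‹MeasurableSpace Ω›)
    (hX : Measurable X) (hY : Measurable Y)
    (hXn : ∀ n, Measurable (Xn n)) (hYn : ∀ n, Measurable (Yn n))
    (hconv : ∀ h : BoundedContinuousFunction (ℝ × ℝ) ℝ,
      TendstoInMeasure μ
        (fun n => μ[(fun ω => h ((Xn n ω : ℝ), (Yn n ω : ℝ))) | 𝔪 n]) atTop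
        (fun _ => ∫ ω, h ((X ω : ℝ), (Y ω : ℝ)) ∂μ)) :
    Tendsto
      (fun n =>
        3 * ∫ ω, condScriptF μ (𝔪 n) (Xn n) ω * condScriptF μ (𝔪 n) (Yn n) ω ∂μ - 3)
      atTop (nhds (spearman μ X Y)) ∧
    Tendsto
      (fun n => ∫ ω, condScriptH μ (𝔪 n) (Xn n) (Yn n) ω ∂μ - 1)
      atTop (nhds (kendall μ X Y)) := by
  have iCdf : ∀ (T : Ω → ℤ), Measurable T → ∀ k,
      ∫ ω, (if T ω ≤ k then (1 : ℝ) else 0) ∂μ = intCdf μ T k := by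
    intro T hT k
    have hs : MeasurableSet {ω | T ω ≤ k} := hT measurableSet_Iic
    have := integral_indicator_one (μ := μ) hs
    simpa [Set.indicator_apply, intCdf, Measure.real] using this
  have iJ : ∀ k l, ∫ ω, (if X ω ≤ k ∧ Y ω ≤ l then (1 : ℝ) else 0) ∂μ
      = intJointCdf μ X Y k l := by
    intro k l
    have hs : MeasurableSet {ω | X ω ≤ k ∧ Y ω ≤ l} :=
      (hX measurableSet_Iic).inter (hY measurableSet_Iic)
    have := integral_indicator_one (μ := μ) hs
    simpa [Set.indicator_apply, intJointCdf, Measure.real] using this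
  have b1 : ∀ x : ℝ, |(fun _ : ℝ => (1 : ℝ)) x| ≤ 1 := by simp
  have LF : ∀ k, Tendsto (fun n => ∫ ω, |condIntCdf μ (𝔪 n) (Xn n) k ω - intCdf μ X k| ∂μ)
      atTop (nhds 0) := by
    intro k
    have := aux_cond μ X Y Xn Yn 𝔪 h𝔪 hconv (fun x _ => if x ≤ k then 1 else 0)
      (auxClamp k) (fun _ => 1) (auxClamp_cont k) continuous_const (auxClamp_bd k) b1
      (fun x y => by rw [auxClamp_int, mul_one])
    rwa [iCdf X hX] at this
  have LG : ∀ k, Tendsto (fun n => ∫ ω, |condIntCdf μ (𝔪 n) (Yn n) k ω - intCdf μ Y k| ∂μ)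
      atTop (nhds 0) := by
    intro k
    have := aux_cond μ X Y Xn Yn 𝔪 h𝔪 hconv (fun _ y => if y ≤ k then 1 else 0)
      (fun _ => 1) (auxClamp k) continuous_const (auxClamp_cont k) b1 (auxClamp_bd k)
      (fun x y => by rw [auxClamp_int, one_mul])
    rwa [iCdf Y hY] at this
  have LH : ∀ k l, Tendsto (fun n => ∫ ω, |condIntJointCdf μ (𝔪 n) (Xn n) (Yn n) k l ω
      - intJointCdf μ X Y k l| ∂μ) atTop (nhds 0) := by
    intro k l
    have := aux_cond μ X Y Xn Yn 𝔪 h𝔪 hconv (fun x y => if x ≤ k ∧ y ≤ l then 1 else 0)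
      (auxClamp k) (auxClamp l) (auxClamp_cont k) (auxClamp_cont l) (auxClamp_bd k)
      (auxClamp_bd l)
      (fun x y => by
        rw [auxClamp_int, auxClamp_int]
        by_cases h1 : x ≤ k <;> by_cases h2 : y ≤ l <;> simp [h1, h2])
    rwa [iJ] at this
  have hW : ∀ n, Measurable (fun ω => (Xn n ω, Yn n ω)) := fun n => (hXn n).prodMk (hYn n)
  have hV : Measurable (fun ω => (X ω, Y ω)) := hX.prodMk hY
  have hq : ∀ p : ℤ × ℤ, Tendsto
      (fun n => ∫ ω, (if (Xn n ω, Yn n ω) = p then (1 : ℝ) else 0) ∂μ) atTop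
      (nhds (∫ ω, (if (X ω, Y ω) = p then (1 : ℝ) else 0) ∂μ)) := by
    rintro ⟨k, l⟩
    have := aux_cond μ X Y Xn Yn 𝔪 h𝔪 hconv (fun x y => if (x, y) = (k, l) then 1 else 0)
      (auxBump k) (auxBump l) (auxBump_cont k) (auxBump_cont l) (auxBump_bd k)
      (auxBump_bd l)
      (fun x y => by
        rw [auxBump_int, auxBump_int]
        by_cases h1 : x = k <;> by_cases h2 : y = l <;> simp [h1, h2])
    rw [tendsto_iff_norm_sub_tendsto_zero]
    refine squeeze_zero (fun n => norm_nonneg _) (fun n => ?_) this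
    rw [← integral_condExp (h𝔪 n) (μ := μ)
      (f := fun ω => if (Xn n ω, Yn n ω) = (k, l) then (1 : ℝ) else 0)]
    refine le_trans (le_of_eq ?_) (abs_integral_le_integral_abs)
    rw [integral_sub integrable_condExp (integrable_const _)]
    simp
  have mF : ∀ n (T : Ω → ℤ) k, Measurable (condIntCdf μ (𝔪 n) T k) := fun n T k =>
    (stronglyMeasurable_condExp.mono (h𝔪 n)).measurable
  have mH : ∀ n (T U : Ω → ℤ) k l, Measurable (condIntJointCdf μ (𝔪 n) T U k l) :=
    fun n T U k l => (stronglyMeasurable_condExp.mono (h𝔪 n)).measurable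
  have bF : ∀ n (T : Ω → ℤ) k, ∀ᵐ ω ∂μ, |condIntCdf μ (𝔪 n) T k ω| ≤ 1 := by
    intro n T k
    have := ae_bdd_abs_condExp_of_ae_bdd_abs (m := 𝔪 n) (μ := μ) (R := (1 : ℝ))
      (f := fun ω => if T ω ≤ k then (1 : ℝ) else 0)
      (ae_of_all _ fun ω => by split_ifs <;> simp)
    exact this
  have bH : ∀ n (T U : Ω → ℤ) k l, ∀ᵐ ω ∂μ, |condIntJointCdf μ (𝔪 n) T U k l ω| ≤ 1 := by
    intro n T U k l
    have := ae_bdd_abs_condExp_of_ae_bdd_abs (m := 𝔪 n) (μ := μ) (R := (1 : ℝ))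
      (f := fun ω => if T ω ≤ k ∧ U ω ≤ l then (1 : ℝ) else 0)
      (ae_of_all _ fun ω => by split_ifs <;> simp)
    exact this
  have nF : ∀ n (T : Ω → ℤ) k, Integrable (condIntCdf μ (𝔪 n) T k) μ :=
    fun n T k => integrable_condExp
  have nH : ∀ n (T U : Ω → ℤ) k l, Integrable (condIntJointCdf μ (𝔪 n) T U k l) μ :=
    fun n T U k l => integrable_condExp
  have bc : ∀ (T : Ω → ℤ) k, |intCdf μ T k| ≤ 1 := fun T k => by
    rw [intCdf, abs_of_nonneg ENNReal.toReal_nonneg]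
    exact measureReal_le_one
  have bj : ∀ k l, |intJointCdf μ X Y k l| ≤ 1 := fun k l => by
    rw [intJointCdf, abs_of_nonneg ENNReal.toReal_nonneg]
    exact measureReal_le_one
  have bs : ∀ (T : Ω → ℤ) k, |scriptF μ T k| ≤ 2 := fun T k => by
    have := abs_add_le (intCdf μ T k) (intCdf μ T (k - 1))
    have h1 := bc T k
    have h2 := bc T (k - 1)
    unfold scriptF
    linarith
  have bS : ∀ n (T : Ω → ℤ) k, ∀ᵐ ω ∂μ,
      |condIntCdf μ (𝔪 n) T k ω + condIntCdf μ (𝔪 n) T (k - 1) ω| ≤ 2 := by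
    intro n T k
    filter_upwards [bF n T k, bF n T (k - 1)] with ω h1 h2
    exact (abs_add_le _ _).trans (by linarith)
  constructor
  · have := aux_core μ
      (fun n p ω => (condIntCdf μ (𝔪 n) (Xn n) p.1 ω + condIntCdf μ (𝔪 n) (Xn n) (p.1 - 1) ω) *
        (condIntCdf μ (𝔪 n) (Yn n) p.2 ω + condIntCdf μ (𝔪 n) (Yn n) (p.2 - 1) ω))
      (fun p => scriptF μ X p.1 * scriptF μ Y p.2)
      (fun n ω => (Xn n ω, Yn n ω)) (fun ω => (X ω, Y ω)) 4 (by norm_num)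
      (fun n p => ((mF _ _ _).add (mF _ _ _)).mul ((mF _ _ _).add (mF _ _ _)))
      hW hV
      (fun n p => by
        filter_upwards [bS n (Xn n) p.1, bS n (Yn n) p.2] with ω h1 h2
        rw [abs_mul]
        exact (mul_le_mul h1 h2 (abs_nonneg _) (by norm_num)).trans (by norm_num))
      (fun p => by
        rw [abs_mul]
        exact (mul_le_mul (bs _ _) (bs _ _) (abs_nonneg _) (by norm_num)).trans (by norm_num))
      (fun p => aux_L1_mul μ _ _ _ _
        (fun n => (nF n (Xn n) _).add (nF n (Xn n) _))
        (fun n => (nF n (Yn n) _).add (nF n (Yn n) _))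
        (fun n => bS n (Xn n) p.1) (bs Y p.2)
        (aux_L1_add μ _ _ _ _ (fun n => nF n _ _) (fun n => nF n _ _) (LF _) (LF _))
        (aux_L1_add μ _ _ _ _ (fun n => nF n _ _) (fun n => nF n _ _) (LG _) (LG _)))
      hq
    exact (this.const_mul 3).sub_const 3
  · have := aux_core μ
      (fun n p ω => condIntJointCdf μ (𝔪 n) (Xn n) (Yn n) p.1 p.2 ω +
        condIntJointCdf μ (𝔪 n) (Xn n) (Yn n) (p.1 - 1) p.2 ω +
        condIntJointCdf μ (𝔪 n) (Xn n) (Yn n) p.1 (p.2 - 1) ω +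
        condIntJointCdf μ (𝔪 n) (Xn n) (Yn n) (p.1 - 1) (p.2 - 1) ω)
      (fun p => scriptH μ X Y p.1 p.2)
      (fun n ω => (Xn n ω, Yn n ω)) (fun ω => (X ω, Y ω)) 4 (by norm_num)
      (fun n p => (((mH _ _ _ _ _).add (mH _ _ _ _ _)).add (mH _ _ _ _ _)).add (mH _ _ _ _ _))
      hW hV
      (fun n p => by
        filter_upwards [bH n (Xn n) (Yn n) p.1 p.2, bH n (Xn n) (Yn n) (p.1 - 1) p.2,
          bH n (Xn n) (Yn n) p.1 (p.2 - 1), bH n (Xn n) (Yn n) (p.1 - 1) (p.2 - 1)]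
          with ω h1 h2 h3 h4
        rw [abs_le] at *
        constructor <;> linarith [h1.1, h1.2, h2.1, h2.2, h3.1, h3.2, h4.1, h4.2])
      (fun p => by
        have h1 := bj p.1 p.2
        have h2 := bj (p.1 - 1) p.2
        have h3 := bj p.1 (p.2 - 1)
        have h4 := bj (p.1 - 1) (p.2 - 1)
        unfold scriptH
        rw [abs_le] at *
        constructor <;> linarith [h1.1, h1.2, h2.1, h2.2, h3.1, h3.2, h4.1, h4.2])
      (fun p => aux_L1_add μ _ _ _ _
        (fun n => ((nH n (Xn n) (Yn n) _ _).add (nH n (Xn n) (Yn n) _ _)).add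
          (nH n (Xn n) (Yn n) _ _))
        (fun n => nH n _ _ _ _)
        (aux_L1_add μ _ _ _ _
          (fun n => (nH n (Xn n) (Yn n) _ _).add (nH n (Xn n) (Yn n) _ _))
          (fun n => nH n _ _ _ _)
          (aux_L1_add μ _ _ _ _ (fun n => nH n _ _ _ _) (fun n => nH n _ _ _ _)
            (LH _ _) (LH _ _)) (LH _ _)) (LH _ _))
      hq
    exact this.sub_const 1
end

section
/- Let G be a finite directed multigraph with |E|≥1 and α,β∈{+,−}. Then the normalized average-rank products satisfy the exact identity (1/|E|)·Σ_{e∈E} (R̄^α(π_*e)/|E|)·(R̄^β(π*e)/|E|) = (1/4)·(1/|E|)·Σ_{e∈E} 𝓕_G^{α,src}(D^α(π_*e))·𝓕_G^{β,tgt}(D^β(π*e)) + (1/(2|E|))·(1 + 1/(2|E|)). -/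
open Finset

/-- Total number of edges of a directed multigraph given by edge multiplicities. -/
def edgeCount {V : Type*} [Fintype V] (m : V × V → ℕ) : ℕ := ∑ e, m e

/-- Out-degree `D⁺(v) = Σ_w m(v,w)`. -/
def outDeg {V : Type*} [Fintype V] (m : V × V → ℕ) (v : V) : ℕ := ∑ w, m (v, w)

/-- In-degree `D⁻(v) = Σ_w m(w,v)`. -/
def inDeg {V : Type*} [Fintype V] (m : V × V → ℕ) (v : V) : ℕ := ∑ w, m (w, v)

/-- Degree of type `α` (`true` = `+` = out, `false` = `−` = in). -/
def deg {V : Type*} [Fintype V] (m : V × V → ℕ) (α : Bool) (v : V) : ℕ :=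
  if α then outDeg m v else inDeg m v

/-- Empirical cdf `F_G^{α,π}(k) = Σ_e (m(e)/|E|)·1{D^α(π e) ≤ k}` for a projection `π`. -/
noncomputable def empCdf {V : Type*} [Fintype V] (m : V × V → ℕ) (α : Bool)
    (π : V × V → V) (k : ℤ) : ℝ :=
  ∑ e, (m e : ℝ) / (edgeCount m : ℝ) * (if (deg m α (π e) : ℤ) ≤ k then 1 else 0)

/-- `𝓕_G^{α,π}(k) = F_G^{α,π}(k) + F_G^{α,π}(k−1)`. -/
noncomputable def empScriptF {V : Type*} [Fintype V] (m : V × V → ℕ) (α : Bool)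
    (π : V × V → V) (k : ℤ) : ℝ :=
  empCdf m α π k + empCdf m α π (k - 1)

/-- Average rank `R̄^α(π e) = 1/2 + Σ_f m(f)·[1{D^α(π f) > D^α(π e)} + (1/2)·1{D^α(π f) = D^α(π e)}]`. -/
noncomputable def avgRank {V : Type*} [Fintype V] (m : V × V → ℕ) (α : Bool)
    (π : V × V → V) (e : V × V) : ℝ :=
  1 / 2 + ∑ f, (m f : ℝ) *
    ((if deg m α (π e) < deg m α (π f) then 1 else 0) +
      1 / 2 * (if deg m α (π f) = deg m α (π e) then 1 else 0))

lemma scriptF_eq {V : Type*} [Fintype V] (m : V × V → ℕ) (α : Bool)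
    (π : V × V → V) (e : V × V) :
    empScriptF m α π (deg m α (π e)) = ∑ f, (m f : ℝ) / (edgeCount m : ℝ) *
      ((if deg m α (π f) ≤ deg m α (π e) then 1 else 0) +
        (if deg m α (π f) < deg m α (π e) then 1 else 0)) := by
  unfold empScriptF empCdf
  rw [← Finset.sum_add_distrib]
  refine Finset.sum_congr rfl fun f _ => ?_
  simp only [Int.le_sub_one_iff, Nat.cast_le, Nat.cast_lt, mul_add]

lemma edgeCount_cast {V : Type*} [Fintype V] (m : V × V → ℕ) :
    ∑ e, (m e : ℝ) = (edgeCount m : ℝ) := by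
  simp [edgeCount]

lemma avgRank_div {V : Type*} [Fintype V] (m : V × V → ℕ)
    (hE : (edgeCount m : ℝ) ≠ 0) (α : Bool) (π : V × V → V) (e : V × V) :
    avgRank m α π e / (edgeCount m : ℝ) =
      (1 + 1 / (2 * (edgeCount m : ℝ))) - empScriptF m α π (deg m α (π e)) / 2 := by
  have h1 : ∑ f, (m f : ℝ) / (edgeCount m : ℝ) = 1 := by
    rw [← Finset.sum_div, edgeCount_cast, div_self hE]
  have h2 : (∑ f, (m f : ℝ) * ((if deg m α (π e) < deg m α (π f) then 1 else 0) +
      1 / 2 * (if deg m α (π f) = deg m α (π e) then 1 else 0))) / (edgeCount m : ℝ)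
      = ∑ f, (m f : ℝ) / (edgeCount m : ℝ) - empScriptF m α π (deg m α (π e)) / 2 := by
    rw [scriptF_eq, Finset.sum_div, Finset.sum_div, ← Finset.sum_sub_distrib]
    refine Finset.sum_congr rfl fun f _ => ?_
    rcases lt_trichotomy (deg m α (π e)) (deg m α (π f)) with h | h | h
    · simp [h, h.ne', h.not_ge, h.not_gt]
    · simp [h]; ring
    · simp [h, h.ne, h.le, h.not_gt]; ring
  unfold avgRank
  rw [add_div, h2, h1]
  field_simp
  ring

lemma sum_scriptF {V : Type*} [Fintype V] (m : V × V → ℕ)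
    (hE : (edgeCount m : ℝ) ≠ 0) (α : Bool) (π : V × V → V) :
    ∑ e, (m e : ℝ) * empScriptF m α π (deg m α (π e)) = (edgeCount m : ℝ) := by
  set T := ∑ e, (m e : ℝ) * empScriptF m α π (deg m α (π e)) with hT
  have a : T = ∑ e, ∑ f, (m e : ℝ) * ((m f : ℝ) / (edgeCount m : ℝ) *
      ((if deg m α (π f) ≤ deg m α (π e) then 1 else 0) +
        (if deg m α (π f) < deg m α (π e) then 1 else 0))) := by
    simp only [hT, scriptF_eq, Finset.mul_sum]
  have b := a
  rw [Finset.sum_comm] at b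
  have c : T + T = ∑ e, ∑ f, (m e : ℝ) * (m f : ℝ) * (2 / (edgeCount m : ℝ)) := by
    nth_rewrite 1 [a]
    rw [b, ← Finset.sum_add_distrib]
    refine Finset.sum_congr rfl fun e _ => ?_
    rw [← Finset.sum_add_distrib]
    refine Finset.sum_congr rfl fun f _ => ?_
    rcases lt_trichotomy (deg m α (π e)) (deg m α (π f)) with h | h | h
    · simp [h, h.le, h.not_ge, h.not_gt]; ring
    · simp [h]; ring
    · simp [h, h.le, h.not_ge, h.not_gt]; ring
  simp only [← Finset.sum_mul, ← Finset.mul_sum, edgeCount_cast] at c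
  field_simp at c
  linarith

/-- The exact identity between the normalized average-rank products and the
empirical `𝓕`-product average for a finite directed multigraph with `|E| ≥ 1`. -/
theorem avgRank_product_identity {V : Type*} [Fintype V] (m : V × V → ℕ)
    (hE : 1 ≤ edgeCount m) (α β : Bool) :
    (1 / (edgeCount m : ℝ)) * ∑ e, (m e : ℝ) *
        (avgRank m α Prod.fst e / (edgeCount m : ℝ)) *
        (avgRank m β Prod.snd e / (edgeCount m : ℝ)) =
      (1 / 4) * ((1 / (edgeCount m : ℝ)) * ∑ e, (m e : ℝ) *
          empScriptF m α Prod.fst (deg m α e.1) * empScriptF m β Prod.snd (deg m β e.2)) +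
        (1 / (2 * (edgeCount m : ℝ))) * (1 + 1 / (2 * (edgeCount m : ℝ))) := by
  have hE' : (edgeCount m : ℝ) ≠ 0 := by
    have : edgeCount m ≠ 0 := by omega
    exact_mod_cast this
  have hA := sum_scriptF m hE' α Prod.fst
  have hB := sum_scriptF m hE' β Prod.snd
  have hC := edgeCount_cast m
  simp only [avgRank_div m hE']
  set N := (edgeCount m : ℝ)
  set c := 1 + 1 / (2 * N) with hc
  have key : ∑ e, (m e : ℝ) * (c - empScriptF m α Prod.fst (deg m α e.1) / 2) *
      (c - empScriptF m β Prod.snd (deg m β e.2) / 2) =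
      c ^ 2 * ∑ e, (m e : ℝ)
      - c / 2 * ∑ e, (m e : ℝ) * empScriptF m α Prod.fst (deg m α e.1)
      - c / 2 * ∑ e, (m e : ℝ) * empScriptF m β Prod.snd (deg m β e.2)
      + 1 / 4 * ∑ e, (m e : ℝ) *
          empScriptF m α Prod.fst (deg m α e.1) * empScriptF m β Prod.snd (deg m β e.2) := by
    simp only [Finset.mul_sum, ← Finset.sum_sub_distrib, ← Finset.sum_add_distrib]
    refine Finset.sum_congr rfl fun e _ => ?_
    ring
  rw [key, hA, hB, hC, hc]
  field_simp
  ring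
end

section
/- Let G be a finite directed multigraph with |E|≥1 and α,β∈{+,−}. Let N_C (resp. N_D) be the number of unordered pairs of distinct edges {e,f} (counted with multiplicity) such that (D^α(π_*e)−D^α(π_*f))·(D^β(π*e)−D^β(π*f)) > 0 (resp. < 0). Then 2(N_C − N_D)/|E|² = (1/|E|)·Σ_{e∈E} 𝓗_G^{α,β}(D^α(π_*e), D^β(π*e)) − 1. -/
open Finset

/-- Empirical joint cdf `H_G^{α,β}(k,l) = Σ_e (m(e)/|E|)·1{D^α(π_*e) ≤ k}·1{D^β(π*e) ≤ l}`. -/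
noncomputable def empJointCdf {V : Type*} [Fintype V] (m : V × V → ℕ) (α β : Bool)
    (k l : ℤ) : ℝ :=
  ∑ e, (m e : ℝ) / (edgeCount m : ℝ) *
    (if (deg m α e.1 : ℤ) ≤ k ∧ (deg m β e.2 : ℤ) ≤ l then 1 else 0)

/-- `𝓗_G^{α,β}(k,l) = H(k,l) + H(k−1,l) + H(k,l−1) + H(k−1,l−1)`. -/
noncomputable def empScriptH {V : Type*} [Fintype V] (m : V × V → ℕ) (α β : Bool)
    (k l : ℤ) : ℝ :=
  empJointCdf m α β k l + empJointCdf m α β (k - 1) l +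
    empJointCdf m α β k (l - 1) + empJointCdf m α β (k - 1) (l - 1)

/-- The kernel identity behind the four-term sum. -/
lemma four_term (a b c d : ℤ) :
    ((if a ≤ c ∧ b ≤ d then 1 else 0) + (if a ≤ c - 1 ∧ b ≤ d then 1 else 0) +
      (if a ≤ c ∧ b ≤ d - 1 then 1 else 0) + (if a ≤ c - 1 ∧ b ≤ d - 1 then 1 else 0) : ℝ) =
    (1 + ((c - a).sign : ℝ)) * (1 + ((d - b).sign : ℝ)) := by
  rcases lt_trichotomy a c with h | h | h <;> rcases lt_trichotomy b d with h' | h' | h'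
  all_goals
    first
    | rw [Int.sign_eq_one_of_pos (show 0 < c - a by omega)]
    | rw [Int.sign_eq_neg_one_of_neg (show c - a < 0 by omega)]
    | rw [show c - a = 0 by omega, Int.sign_zero]
    first
    | rw [Int.sign_eq_one_of_pos (show 0 < d - b by omega)]
    | rw [Int.sign_eq_neg_one_of_neg (show d - b < 0 by omega)]
    | rw [show d - b = 0 by omega, Int.sign_zero]
    split_ifs <;> first | omega | norm_num

/-- Concordance minus discordance indicator is the product of signs. -/
lemma conc_sub_disc (x y : ℤ) :
    ((if 0 < x * y then 1 else 0) - (if x * y < 0 then 1 else 0) : ℝ) =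
      (x.sign : ℝ) * (y.sign : ℝ) := by
  rw [← Int.cast_mul, ← Int.sign_mul]
  rcases lt_trichotomy (x * y) 0 with h | h | h
  · rw [Int.sign_eq_neg_one_of_neg h, if_neg (by omega), if_pos h]; norm_num
  · rw [h]; norm_num
  · rw [Int.sign_eq_one_of_pos h, if_pos h, if_neg (by omega)]; norm_num

/-- Antisymmetric sums vanish. -/
lemma antisymm_sum {ι : Type*} [Fintype ι] (w : ι → ℝ) (x : ι → ℤ) :
    ∑ e, ∑ f, w e * w f * ((x e - x f).sign : ℝ) = 0 := by
  have h : ∑ e, ∑ f, w e * w f * ((x e - x f).sign : ℝ) =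
      - ∑ e, ∑ f, w e * w f * ((x e - x f).sign : ℝ) := by
    conv_lhs => rw [Finset.sum_comm]
    rw [← Finset.sum_neg_distrib]
    refine Finset.sum_congr rfl fun e _ => ?_
    rw [← Finset.sum_neg_distrib]
    refine Finset.sum_congr rfl fun f _ => ?_
    rw [← neg_sub (x e) (x f), Int.sign_neg]
    push_cast
    ring
  linarith

/-- Sums over pairs of individual edges are multiplicity-weighted sums. -/
lemma sum_pairs {ι : Type*} [Fintype ι] (m : ι → ℕ) (g : ι → ι → ℝ) :
    ∑ p : ((e : ι) × Fin (m e)) × ((e : ι) × Fin (m e)), g p.1.1 p.2.1 =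
      ∑ e, ∑ f, (m e : ℝ) * (m f : ℝ) * g e f := by
  rw [Fintype.sum_prod_type]
  simp only [Fintype.sum_sigma, Finset.sum_const, Finset.card_univ, Fintype.card_fin,
    nsmul_eq_mul, Finset.mul_sum, mul_assoc]

/-- Writing `N_C` (resp. `N_D`) for the number of unordered pairs of
distinct edges (counted with multiplicity, here realized as half the number of ordered
pairs, the condition being symmetric) that are concordant (resp. discordant),
`2(N_C − N_D)/|E|² = (1/|E|)·Σ_{e∈E} 𝓗_G^{α,β}(D^α(π_*e), D^β(π*e)) − 1`. -/
theorem concordant_discordant_identity {V : Type*} [Fintype V] [DecidableEq V]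
    (m : V × V → ℕ) (hE : 1 ≤ edgeCount m) (α β : Bool) :
    2 * (((Finset.univ.filter (fun p : ((e : V × V) × Fin (m e)) × ((e : V × V) × Fin (m e)) =>
            p.1 ≠ p.2 ∧ 0 < ((deg m α p.1.1.1 : ℤ) - (deg m α p.2.1.1 : ℤ)) *
              ((deg m β p.1.1.2 : ℤ) - (deg m β p.2.1.2 : ℤ)))).card : ℝ) / 2 -
          ((Finset.univ.filter (fun p : ((e : V × V) × Fin (m e)) × ((e : V × V) × Fin (m e)) =>
            p.1 ≠ p.2 ∧ ((deg m α p.1.1.1 : ℤ) - (deg m α p.2.1.1 : ℤ)) *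
              ((deg m β p.1.1.2 : ℤ) - (deg m β p.2.1.2 : ℤ)) < 0)).card : ℝ) / 2) /
        ((edgeCount m : ℝ)) ^ 2 =
      (1 / (edgeCount m : ℝ)) * ∑ e, (m e : ℝ) *
          empScriptH m α β (deg m α e.1) (deg m β e.2) - 1 := by
  have hE' : (edgeCount m : ℝ) ≠ 0 := by
    have : edgeCount m ≠ 0 := by omega
    exact_mod_cast this
  have hN : ∑ e, (m e : ℝ) = (edgeCount m : ℝ) := by simp [edgeCount]
  set x : V × V → ℤ := fun e => (deg m α e.1 : ℤ) with hx
  set y : V × V → ℤ := fun e => (deg m β e.2 : ℤ) with hy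
  have hC : ((Finset.univ.filter
        (fun p : ((e : V × V) × Fin (m e)) × ((e : V × V) × Fin (m e)) =>
          p.1 ≠ p.2 ∧ 0 < ((deg m α p.1.1.1 : ℤ) - (deg m α p.2.1.1 : ℤ)) *
            ((deg m β p.1.1.2 : ℤ) - (deg m β p.2.1.2 : ℤ)))).card : ℝ) =
      ∑ e, ∑ f, (m e : ℝ) * (m f : ℝ) *
        (if 0 < (x e - x f) * (y e - y f) then 1 else 0) := by
    rw [← sum_pairs m (fun e f => if 0 < (x e - x f) * (y e - y f) then (1 : ℝ) else 0),
      Finset.sum_boole]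
    congr 2
    ext p
    simp only [Finset.mem_filter, Finset.mem_univ, true_and, hx, hy]
    refine ⟨fun h => h.2, fun h => ⟨fun h' => ?_, h⟩⟩
    rw [h'] at h
    simp at h
  have hD : ((Finset.univ.filter
        (fun p : ((e : V × V) × Fin (m e)) × ((e : V × V) × Fin (m e)) =>
          p.1 ≠ p.2 ∧ ((deg m α p.1.1.1 : ℤ) - (deg m α p.2.1.1 : ℤ)) *
            ((deg m β p.1.1.2 : ℤ) - (deg m β p.2.1.2 : ℤ)) < 0)).card : ℝ) =
      ∑ e, ∑ f, (m e : ℝ) * (m f : ℝ) *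
        (if (x e - x f) * (y e - y f) < 0 then 1 else 0) := by
    rw [← sum_pairs m (fun e f => if (x e - x f) * (y e - y f) < 0 then (1 : ℝ) else 0),
      Finset.sum_boole]
    congr 2
    ext p
    simp only [Finset.mem_filter, Finset.mem_univ, true_and, hx, hy]
    refine ⟨fun h => h.2, fun h => ⟨fun h' => ?_, h⟩⟩
    rw [h'] at h
    simp at h
  have hCD : ∑ e, ∑ f, (m e : ℝ) * (m f : ℝ) *
        (if 0 < (x e - x f) * (y e - y f) then 1 else 0) -
      ∑ e, ∑ f, (m e : ℝ) * (m f : ℝ) *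
        (if (x e - x f) * (y e - y f) < 0 then 1 else 0) =
      ∑ e, ∑ f, (m e : ℝ) * (m f : ℝ) * (((x e - x f).sign : ℝ) * ((y e - y f).sign : ℝ)) := by
    simp only [← Finset.sum_sub_distrib, ← mul_sub, conc_sub_disc]
  have hH : ∀ e : V × V, empScriptH m α β (deg m α e.1) (deg m β e.2) =
      (∑ f, (m f : ℝ) * ((1 + ((x e - x f).sign : ℝ)) * (1 + ((y e - y f).sign : ℝ)))) /
        (edgeCount m : ℝ) := by
    intro e
    unfold empScriptH empJointCdf
    rw [← Finset.sum_add_distrib, ← Finset.sum_add_distrib, ← Finset.sum_add_distrib,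
      Finset.sum_div]
    refine Finset.sum_congr rfl fun f _ => ?_
    rw [← four_term]
    ring
  have hS : ∑ e, (m e : ℝ) * empScriptH m α β (deg m α e.1) (deg m β e.2) =
      ((edgeCount m : ℝ) ^ 2 +
        ∑ e, ∑ f, (m e : ℝ) * (m f : ℝ) *
          (((x e - x f).sign : ℝ) * ((y e - y f).sign : ℝ))) / (edgeCount m : ℝ) := by
    have h1 := antisymm_sum (fun e => (m e : ℝ)) x
    have h2 := antisymm_sum (fun e => (m e : ℝ)) y
    have h3 : ∑ e, ∑ f, (m e : ℝ) * (m f : ℝ) = (edgeCount m : ℝ) ^ 2 := by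
      rw [← Finset.sum_mul_sum, hN, sq]
    rw [← h3, ← add_zero (∑ e, ∑ f, (m e : ℝ) * (m f : ℝ)), ← h1,
      ← add_zero (∑ e, ∑ f, (m e : ℝ) * (m f : ℝ) + _), ← h2]
    simp only [← Finset.sum_add_distrib]
    rw [Finset.sum_div]
    refine Finset.sum_congr rfl fun e _ => ?_
    rw [hH, mul_div_assoc', Finset.mul_sum]
    congr 1
    refine Finset.sum_congr rfl fun f _ => ?_
    ring
  rw [hC, hD, hS, ← sub_div, hCD]
  field_simp
  ring
end

section
/- Let α,β∈{+,−} and let (G_n)_{n∈ℕ} be a sequence of random directed multigraphs satisfying the regularity condition, with |E_n|→∞ in probability. Then Spearman's rho with average-rank tie resolution converges: ρ̄_α^β(G_n) → ρ(𝒟^α,𝒟^β)/(3·√(S_{𝒟^α}·S_{𝒟^β})) in probability as n→∞, where S_X = E[F_X(X)·F_X(X−1)] and ρ(X,Y)=3·E[𝓕_X(X)𝓕_Y(Y)]−3. -/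
open Finset MeasureTheory ProbabilityTheory Filter

/-- `S_X = E[F_X(X)·F_X(X−1)]`. -/
noncomputable def sFactor {Ω : Type*} [MeasurableSpace Ω] (μ : Measure Ω)
    (X : Ω → ℤ) : ℝ :=
  ∫ ω, intCdf μ X (X ω) * intCdf μ X (X ω - 1) ∂μ

/-! ### The three rank-correlation statistics of a multigraph -/

/-- The random rank of the `i`-th copy of edge `e` computed from realized tie-breaking
values `u` (indexed by an edge slot together with a copy index):
`R^α(π e) = Σ_{f∈E} 1{D^α(π f) + u_f ≥ D^α(π e) + u_e}`. -/
noncomputable def rank {V : Type*} [Fintype V] (m : V × V → ℕ) (α : Bool)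
    (π : V × V → V) (u : (V × V) × ℕ → ℝ) (e : V × V) (i : ℕ) : ℝ :=
  ∑ f : V × V, ∑ j ∈ Finset.range (m f),
    if (deg m α (π e) : ℝ) + u (e, i) ≤ (deg m α (π f) : ℝ) + u (f, j) then 1 else 0

/-- Spearman's rho with uniform tie-breaking:
`ρ_α^β(G) = [12·Σ_{e∈E} R^α(π_*e)R^β(π*e) − 3|E|(|E|+1)²]/(|E|³−|E|)`. -/
noncomputable def rhoStat {V : Type*} [Fintype V] (m : V × V → ℕ) (α β : Bool)
    (u w : (V × V) × ℕ → ℝ) : ℝ :=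
  (12 * ∑ e : V × V, ∑ i ∈ Finset.range (m e),
      rank m α Prod.fst u e i * rank m β Prod.snd w e i -
    3 * (edgeCount m : ℝ) * ((edgeCount m : ℝ) + 1) ^ 2) /
  ((edgeCount m : ℝ) ^ 3 - (edgeCount m : ℝ))

/-- Spearman's rho with average-rank tie resolution (`0` by Lean's conventions for `/0`
if a denominator factor vanishes). -/
noncomputable def rhoBarStat {V : Type*} [Fintype V] (m : V × V → ℕ) (α β : Bool) : ℝ :=
  (4 * ∑ e : V × V, (m e : ℝ) * avgRank m α Prod.fst e * avgRank m β Prod.snd e -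
    (edgeCount m : ℝ) * ((edgeCount m : ℝ) + 1) ^ 2) /
  (Real.sqrt (4 * ∑ e : V × V, (m e : ℝ) * avgRank m α Prod.fst e ^ 2 -
      (edgeCount m : ℝ) * ((edgeCount m : ℝ) + 1) ^ 2) *
   Real.sqrt (4 * ∑ e : V × V, (m e : ℝ) * avgRank m β Prod.snd e ^ 2 -
      (edgeCount m : ℝ) * ((edgeCount m : ℝ) + 1) ^ 2))

/-- Kendall's tau statistic `τ_α^β(G) = 2(N_C − N_D)/(|E|(|E|−1))`; here `2N_C` (resp.
`2N_D`) is realized as the number of *ordered* pairs of distinct concordant (resp.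
discordant) edges, the conditions being symmetric. -/
noncomputable def tauStat {V : Type*} [Fintype V] [DecidableEq V]
    (m : V × V → ℕ) (α β : Bool) : ℝ :=
  (((Finset.univ.filter (fun p : ((e : V × V) × Fin (m e)) × ((e : V × V) × Fin (m e)) =>
        p.1 ≠ p.2 ∧ 0 < ((deg m α p.1.1.1 : ℤ) - (deg m α p.2.1.1 : ℤ)) *
          ((deg m β p.1.1.2 : ℤ) - (deg m β p.2.1.2 : ℤ)))).card : ℝ) -
    ((Finset.univ.filter (fun p : ((e : V × V) × Fin (m e)) × ((e : V × V) × Fin (m e)) =>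
        p.1 ≠ p.2 ∧ ((deg m α p.1.1.1 : ℤ) - (deg m α p.2.1.1 : ℤ)) *
          ((deg m β p.1.1.2 : ℤ) - (deg m β p.2.1.2 : ℤ)) < 0)).card : ℝ)) /
  ((edgeCount m : ℝ) * ((edgeCount m : ℝ) - 1))

/-! ### Auxiliary material for the proof -/

section Aux

lemma intCdf_nonneg {Ω : Type*} [MeasurableSpace Ω] (P : Measure Ω) (X : Ω → ℤ) (k : ℤ) :
    0 ≤ intCdf P X k := ENNReal.toReal_nonneg

lemma intCdf_le_one {Ω : Type*} [MeasurableSpace Ω] (P : Measure Ω) [IsProbabilityMeasure P]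
    (X : Ω → ℤ) (k : ℤ) : intCdf P X k ≤ 1 := measureReal_le_one

lemma intCdf_eq_integral {Ω : Type*} [MeasurableSpace Ω] (P : Measure Ω)
    (X : Ω → ℤ) (hX : Measurable X) (k : ℤ) :
    intCdf P X k = ∫ x, (if X x ≤ k then (1 : ℝ) else 0) ∂P := by
  have hs : MeasurableSet {x | X x ≤ k} := hX measurableSet_Iic
  have := integral_indicator_one (μ := P) hs
  rw [intCdf, ← measureReal_def, ← this]
  congr 1
  ext x
  simp [Set.indicator_apply]

lemma intJointCdf_eq_integral {Ω : Type*} [MeasurableSpace Ω] (P : Measure Ω)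
    (X Y : Ω → ℤ) (hX : Measurable X) (hY : Measurable Y) (k l : ℤ) :
    intJointCdf P X Y k l = ∫ x, (if X x ≤ k ∧ Y x ≤ l then (1 : ℝ) else 0) ∂P := by
  have hs : MeasurableSet {x | X x ≤ k ∧ Y x ≤ l} :=
    (hX measurableSet_Iic).inter (hY measurableSet_Iic)
  have := integral_indicator_one (μ := P) hs
  rw [intJointCdf, ← measureReal_def, ← this]
  congr 1
  ext x
  simp [Set.indicator_apply]

/-- Point masses from the joint cdf. -/
lemma point_mass_eq (P : Measure (ℤ × ℤ)) [IsProbabilityMeasure P] (x : ℤ × ℤ) :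
    P.real {x} = intJointCdf P Prod.fst Prod.snd x.1 x.2
      - intJointCdf P Prod.fst Prod.snd (x.1 - 1) x.2
      - intJointCdf P Prod.fst Prod.snd x.1 (x.2 - 1)
      + intJointCdf P Prod.fst Prod.snd (x.1 - 1) (x.2 - 1) := by
  have hi : ∀ k l : ℤ, Integrable (fun y : ℤ × ℤ => if y.1 ≤ k ∧ y.2 ≤ l then (1 : ℝ) else 0) P := by
    intro k l
    refine Integrable.of_bound (C := 1) (measurable_of_countable _).aestronglyMeasurable ?_
    refine Eventually.of_forall fun y => ?_
    split_ifs <;> simp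
  have h1 : P.real {x} = ∫ y, (if y = x then (1 : ℝ) else 0) ∂P := by
    rw [← integral_indicator_one (measurableSet_singleton x)]
    congr 1
    ext y
    simp [Set.indicator_apply]
  simp only [intJointCdf_eq_integral P _ _ measurable_fst measurable_snd]
  rw [h1, ← integral_sub (hi _ _) (hi _ _), ← integral_sub, ← integral_add]
  rotate_left
  · exact ((hi _ _).sub (hi _ _)).sub (hi _ _)
  · exact hi _ _
  · exact (hi _ _).sub (hi _ _)
  · exact hi _ _
  congr 1
  ext y
  obtain ⟨a, b⟩ := x
  obtain ⟨c, d⟩ := y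
  simp only [Prod.mk.injEq]
  split_ifs <;> first | omega | norm_num

/-- A finite set carrying almost all of the mass. -/
lemma exists_finset_mass (P : Measure (ℤ × ℤ)) [IsProbabilityMeasure P] {ε : ℝ} (hε : 0 < ε) :
    ∃ B : Finset (ℤ × ℤ), P.real ((B : Set (ℤ × ℤ))ᶜ) < ε := by
  let B : ℕ → Finset (ℤ × ℤ) := fun N => Finset.Icc (-(N : ℤ)) N ×ˢ Finset.Icc (-(N : ℤ)) N
  have hmono : Monotone fun N => (B N : Set (ℤ × ℤ)) := by
    intro a b hab x hx
    simp only [B, Finset.coe_product, Finset.coe_Icc, Set.mem_prod, Set.mem_Icc] at hx ⊢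
    omega
  have hU : (⋃ N, (B N : Set (ℤ × ℤ))) = Set.univ := by
    ext x
    simp only [B, Finset.coe_product, Finset.coe_Icc, Set.mem_iUnion, Set.mem_prod, Set.mem_Icc,
      Set.mem_univ, iff_true]
    refine ⟨x.1.natAbs + x.2.natAbs, ?_⟩
    omega
  have h := tendsto_measure_iUnion_atTop (μ := P) hmono
  rw [hU, measure_univ] at h
  have h2 := (ENNReal.tendsto_toReal ENNReal.one_ne_top).comp h
  have h3 : ∀ᶠ N in atTop, 1 - ε < P.real (B N : Set (ℤ × ℤ)) :=
    h2.eventually (lt_mem_nhds (by simpa using hε))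
  obtain ⟨N, hN⟩ := h3.exists
  refine ⟨B N, ?_⟩
  rw [probReal_compl_eq_one_sub (B N).measurableSet]
  linarith

lemma integral_split (P : Measure (ℤ × ℤ)) [IsProbabilityMeasure P] (B : Finset (ℤ × ℤ))
    (a : ℤ × ℤ → ℝ) (C : ℝ) (ha : ∀ x, |a x| ≤ C) :
    |∫ x, a x ∂P - ∑ x ∈ B, P.real {x} * a x| ≤ C * P.real ((B : Set (ℤ × ℤ))ᶜ) := by
  have hint : Integrable a P :=
    Integrable.of_bound (C := C) (measurable_of_countable _).aestronglyMeasurable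
      (Eventually.of_forall ha)
  have h1 := integral_add_compl B.measurableSet hint
  have h2 := setIntegral_finset (μ := P) B hint.integrableOn
  rw [← h1, h2]
  simp only [smul_eq_mul, add_sub_cancel_left]
  rw [← Real.norm_eq_abs]
  exact norm_setIntegral_le_of_norm_le_const (f := a) (measure_lt_top _ _)
    (fun x _ => (Real.norm_eq_abs (a x)).le.trans (ha x))

lemma tendsto_integral_aux {ι : Type*} {L : Filter ι} (P : ι → Measure (ℤ × ℤ))
    (Q : Measure (ℤ × ℤ)) [∀ i, IsProbabilityMeasure (P i)] [IsProbabilityMeasure Q]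
    (h : ∀ x, Tendsto (fun i => (P i).real {x}) L (nhds (Q.real {x})))
    (a : ι → ℤ × ℤ → ℝ) (b : ℤ × ℤ → ℝ) (C : ℝ) (hC : 0 < C)
    (ha : ∀ i x, |a i x| ≤ C) (hb : ∀ x, |b x| ≤ C)
    (hab : ∀ x, Tendsto (fun i => a i x) L (nhds (b x))) :
    Tendsto (fun i => ∫ x, a i x ∂(P i)) L (nhds (∫ x, b x ∂Q)) := by
  rw [Metric.tendsto_nhds]
  intro ε hε
  obtain ⟨B, hB⟩ := exists_finset_mass Q (ε := ε / (4 * C)) (by positivity)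
  have hmass : Tendsto (fun i => (P i).real ((B : Set (ℤ × ℤ))ᶜ)) L
      (nhds (Q.real ((B : Set (ℤ × ℤ))ᶜ))) := by
    have e : ∀ (R : Measure (ℤ × ℤ)) [IsProbabilityMeasure R],
        R.real ((B : Set (ℤ × ℤ))ᶜ) = 1 - ∑ x ∈ B, R.real {x} := by
      intro R _
      rw [probReal_compl_eq_one_sub B.measurableSet, sum_measureReal_singleton]
    simp only [e]
    exact tendsto_const_nhds.sub (tendsto_finset_sum _ fun x _ => h x)
  have hsum : Tendsto (fun i => ∑ x ∈ B, (P i).real {x} * a i x) L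
      (nhds (∑ x ∈ B, Q.real {x} * b x)) :=
    tendsto_finset_sum _ fun x _ => (h x).mul (hab x)
  filter_upwards [hmass.eventually (gt_mem_nhds hB),
    Metric.tendsto_nhds.1 hsum (ε / 4) (by positivity)] with i h1 h2
  have h3 := integral_split (P i) B (a i) C (ha i)
  have h4 := integral_split Q B b C hb
  have h5 : C * (ε / (4 * C)) = ε / 4 := by field_simp
  have h6 : C * (P i).real ((B : Set (ℤ × ℤ))ᶜ) < ε / 4 := h5 ▸ mul_lt_mul_of_pos_left h1 hC
  have h7 : C * Q.real ((B : Set (ℤ × ℤ))ᶜ) < ε / 4 := h5 ▸ mul_lt_mul_of_pos_left hB hC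
  rw [Real.dist_eq] at h2 ⊢
  rw [abs_le] at h3 h4
  rw [abs_lt] at h2 ⊢
  constructor <;> linarith [h3.1, h3.2, h4.1, h4.2, h2.1, h2.2]

lemma scriptF_abs_le {Ω : Type*} [MeasurableSpace Ω] (P : Measure Ω) [IsProbabilityMeasure P]
    (X : Ω → ℤ) (k : ℤ) : |scriptF P X k| ≤ 2 := by
  have h1 := intCdf_nonneg P X k
  have h2 := intCdf_nonneg P X (k - 1)
  have h3 := intCdf_le_one P X k
  have h4 := intCdf_le_one P X (k - 1)
  unfold scriptF
  rw [abs_le]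
  constructor <;> linarith

lemma tendsto_scriptF {ι : Type*} {L : Filter ι} (P : ι → Measure (ℤ × ℤ))
    (Q : Measure (ℤ × ℤ)) [∀ i, IsProbabilityMeasure (P i)] [IsProbabilityMeasure Q]
    (h : ∀ x, Tendsto (fun i => (P i).real {x}) L (nhds (Q.real {x})))
    (X : ℤ × ℤ → ℤ) (k : ℤ) :
    Tendsto (fun i => scriptF (P i) X k) L (nhds (scriptF Q X k)) := by
  have hX : Measurable X := measurable_of_countable _
  have : ∀ k, Tendsto (fun i => intCdf (P i) X k) L (nhds (intCdf Q X k)) := by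
    intro k
    simp only [intCdf_eq_integral _ X hX]
    have hb : ∀ x, |(if X x ≤ k then (1 : ℝ) else 0)| ≤ 1 := by
      intro x; split_ifs <;> simp
    exact tendsto_integral_aux P Q h _ _ 1 one_pos (fun _ => hb) hb (fun x => tendsto_const_nhds)
  exact (this k).add (this (k - 1))

lemma tendsto_EFF {ι : Type*} {L : Filter ι} (P : ι → Measure (ℤ × ℤ))
    (Q : Measure (ℤ × ℤ)) [∀ i, IsProbabilityMeasure (P i)] [IsProbabilityMeasure Q]
    (h : ∀ x, Tendsto (fun i => (P i).real {x}) L (nhds (Q.real {x})))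
    (X Y : ℤ × ℤ → ℤ) :
    Tendsto (fun i => ∫ x, scriptF (P i) X (X x) * scriptF (P i) Y (Y x) ∂(P i)) L
      (nhds (∫ x, scriptF Q X (X x) * scriptF Q Y (Y x) ∂Q)) := by
  have hb : ∀ (R : Measure (ℤ × ℤ)) [IsProbabilityMeasure R] (x : ℤ × ℤ),
      |scriptF R X (X x) * scriptF R Y (Y x)| ≤ 4 := by
    intro R _ x
    rw [abs_mul]
    nlinarith [scriptF_abs_le R X (X x), scriptF_abs_le R Y (Y x),
      abs_nonneg (scriptF R X (X x)), abs_nonneg (scriptF R Y (Y x))]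
  exact tendsto_integral_aux P Q h _ _ 4 (by norm_num) (fun i => hb (P i)) (hb Q)
    (fun x => (tendsto_scriptF P Q h X _).mul (tendsto_scriptF P Q h Y _))

/-! ### Telescoping identities -/

lemma intCdf_sub {Ω : Type*} [MeasurableSpace Ω] (P : Measure Ω) [IsProbabilityMeasure P]
    (X : Ω → ℤ) (hX : Measurable X) (k : ℤ) :
    intCdf P X k - intCdf P X (k - 1) = P.real {x | X x = k} := by
  have hs : MeasurableSet {x | X x ≤ k - 1} := hX measurableSet_Iic
  have : {x | X x = k} = {x | X x ≤ k} \ {x | X x ≤ k - 1} := by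
    ext x; simp only [Set.mem_setOf_eq, Set.mem_diff]; omega
  rw [this, measureReal_diff (by intro x hx; simp only [Set.mem_setOf_eq] at hx ⊢; omega) hs]
  rfl

lemma intCdf_tendsto_top {Ω : Type*} [MeasurableSpace Ω] (P : Measure Ω) [IsProbabilityMeasure P]
    (X : Ω → ℤ) : Tendsto (fun N : ℕ => intCdf P X N) atTop (nhds 1) := by
  have hmono : Monotone fun N : ℕ => {x | X x ≤ N} := by
    intro a b hab x hx
    simp only [Set.mem_setOf_eq] at hx ⊢; omega
  have hU : (⋃ N : ℕ, {x | X x ≤ N}) = Set.univ := by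
    ext x
    simp only [Set.mem_iUnion, Set.mem_setOf_eq, Set.mem_univ, iff_true]
    exact ⟨(X x).natAbs, by omega⟩
  have h := tendsto_measure_iUnion_atTop (μ := P) hmono
  rw [hU, measure_univ] at h
  exact (ENNReal.tendsto_toReal ENNReal.one_ne_top).comp h

lemma intCdf_tendsto_bot {Ω : Type*} [MeasurableSpace Ω] (P : Measure Ω) [IsProbabilityMeasure P]
    (X : Ω → ℤ) (hX : Measurable X) :
    Tendsto (fun N : ℕ => intCdf P X (-(N : ℤ) - 1)) atTop (nhds 0) := by
  have hanti : Antitone fun N : ℕ => {x | X x ≤ -(N : ℤ) - 1} := by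
    intro a b hab x hx
    simp only [Set.mem_setOf_eq] at hx ⊢; omega
  have hU : (⋂ N : ℕ, {x | X x ≤ -(N : ℤ) - 1}) = ∅ := by
    ext x
    simp only [Set.mem_iInter, Set.mem_setOf_eq, Set.mem_empty_iff_false, iff_false, not_forall]
    exact ⟨(X x).natAbs, by omega⟩
  have h := tendsto_measure_iInter_atTop (μ := P)
    (s := fun N : ℕ => {x | X x ≤ -(N : ℤ) - 1})
    (fun N => (hX measurableSet_Iic).nullMeasurableSet)
    hanti ⟨0, measure_ne_top _ _⟩
  rw [hU, measure_empty] at h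
  exact (ENNReal.tendsto_toReal ENNReal.zero_ne_top).comp h

lemma sum_telescope_int (G : ℤ → ℝ) (N : ℕ) :
    ∑ k ∈ Finset.Icc (-(N : ℤ)) N, (G k - G (k - 1)) = G N - G (-(N : ℤ) - 1) := by
  induction N with
  | zero => simp
  | succ n ih =>
    have : Finset.Icc (-((n + 1 : ℕ) : ℤ)) ((n + 1 : ℕ) : ℤ)
        = insert (-((n : ℤ) + 1)) (insert ((n : ℤ) + 1) (Finset.Icc (-(n : ℤ)) n)) := by
      ext x; simp only [Finset.mem_Icc, Finset.mem_insert]; push_cast; omega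
    rw [this, Finset.sum_insert, Finset.sum_insert, ih]
    · push_cast
      have e1 : (n : ℤ) + 1 - 1 = n := by ring
      have e2 : -(n : ℤ) - 1 = -((n : ℤ) + 1) := by ring
      rw [e1, e2]; ring
    · simp
    · simp only [Finset.mem_insert, Finset.mem_Icc]; omega

/-- Integrals of functions with telescoping masses. -/
lemma integral_telescope {Ω : Type*} [MeasurableSpace Ω] (P : Measure Ω) [IsProbabilityMeasure P]
    (X : Ω → ℤ) (hX : Measurable X) (g : ℤ → ℝ) (C : ℝ) (hg : ∀ k, |g k| ≤ C) (j : ℕ)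
    (hj : j ≠ 0)
    (h : ∀ k, (intCdf P X k - intCdf P X (k - 1)) * g k
      = intCdf P X k ^ j - intCdf P X (k - 1) ^ j) :
    ∫ x, g (X x) ∂P = 1 := by
  have hmap : IsProbabilityMeasure (P.map X) := Measure.isProbabilityMeasure_map hX.aemeasurable
  have hgm : Measurable g := measurable_of_countable _
  rw [← integral_map (μ := P) hX.aemeasurable hgm.aestronglyMeasurable]
  have hint : Integrable g (P.map X) :=
    Integrable.of_bound (C := C) hgm.aestronglyMeasurable (Eventually.of_forall hg)
  have hU : (⋃ N : ℕ, ((Finset.Icc (-(N : ℤ)) N : Finset ℤ) : Set ℤ)) = Set.univ := by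
    ext x
    simp only [Finset.coe_Icc, Set.mem_iUnion, Set.mem_Icc, Set.mem_univ, iff_true]
    exact ⟨x.natAbs, by omega⟩
  have hmono : Monotone fun N : ℕ => ((Finset.Icc (-(N : ℤ)) N : Finset ℤ) : Set ℤ) := by
    intro a b hab x hx
    simp only [Finset.coe_Icc, Set.mem_Icc] at hx ⊢; omega
  have h1 := tendsto_setIntegral_of_monotone (μ := P.map X) (f := g)
    (fun N : ℕ => (Finset.Icc (-(N : ℤ)) N).measurableSet) hmono hint.integrableOn
  rw [hU, setIntegral_univ] at h1
  refine tendsto_nhds_unique h1 ?_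
  have h2 : ∀ N : ℕ, ∫ x in ((Finset.Icc (-(N : ℤ)) N : Finset ℤ) : Set ℤ), g x ∂(P.map X)
      = intCdf P X N ^ j - intCdf P X (-(N : ℤ) - 1) ^ j := by
    intro N
    rw [setIntegral_finset _ hint.integrableOn, ← sum_telescope_int (fun k => intCdf P X k ^ j)]
    refine Finset.sum_congr rfl fun k _ => ?_
    rw [← h k, intCdf_sub P X hX, smul_eq_mul, map_measureReal_apply hX (measurableSet_singleton k)]
    rfl
  simp only [h2]
  have := ((intCdf_tendsto_top P X).pow j).sub ((intCdf_tendsto_bot P X hX).pow j)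
  simpa [hj] using this

lemma integral_scriptF {Ω : Type*} [MeasurableSpace Ω] (P : Measure Ω) [IsProbabilityMeasure P]
    (X : Ω → ℤ) (hX : Measurable X) : ∫ x, scriptF P X (X x) ∂P = 1 :=
  integral_telescope P X hX _ 2 (scriptF_abs_le P X) 2 (by norm_num)
    (fun k => by unfold scriptF; ring)

lemma integrable_of_int {Ω : Type*} [MeasurableSpace Ω] (P : Measure Ω) [IsProbabilityMeasure P]
    (X : Ω → ℤ) (hX : Measurable X) (g : ℤ → ℝ) (C : ℝ) (hg : ∀ k, |g k| ≤ C) :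
    Integrable (fun x => g (X x)) P :=
  Integrable.of_bound (C := C) ((measurable_of_countable g).comp hX).aestronglyMeasurable
    (Eventually.of_forall fun x => hg (X x))

lemma sFactor_eq {Ω : Type*} [MeasurableSpace Ω] (P : Measure Ω) [IsProbabilityMeasure P]
    (X : Ω → ℤ) (hX : Measurable X) :
    sFactor P X = ∫ x, scriptF P X (X x) * scriptF P X (X x) ∂P - 1 := by
  have hb : ∀ k, |intCdf P X k ^ 2 + intCdf P X k * intCdf P X (k - 1) + intCdf P X (k - 1) ^ 2|
      ≤ 3 := by
    intro k
    have h1 := intCdf_nonneg P X k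
    have h2 := intCdf_nonneg P X (k - 1)
    have h3 := intCdf_le_one P X k
    have h4 := intCdf_le_one P X (k - 1)
    rw [abs_of_nonneg (by positivity)]
    nlinarith [mul_le_one₀ h3 h2 h4]
  have hb2 : ∀ k, |intCdf P X k * intCdf P X (k - 1)| ≤ 1 := by
    intro k
    have h1 := intCdf_nonneg P X k
    have h2 := intCdf_nonneg P X (k - 1)
    rw [abs_of_nonneg (by positivity)]
    exact mul_le_one₀ (intCdf_le_one P X k) h2 (intCdf_le_one P X (k - 1))
  have h1 := integral_telescope P X hX _ 3 hb 3 (by norm_num) (fun k => by ring)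
  rw [sFactor]
  have h2 : ∫ x, scriptF P X (X x) * scriptF P X (X x) ∂P
      = ∫ x, (intCdf P X (X x) ^ 2 + intCdf P X (X x) * intCdf P X (X x - 1)
          + intCdf P X (X x - 1) ^ 2) ∂P
        + ∫ x, intCdf P X (X x) * intCdf P X (X x - 1) ∂P := by
    rw [← integral_add (integrable_of_int P X hX _ _ hb) (integrable_of_int P X hX _ _ hb2)]
    congr 1
    ext x
    unfold scriptF; ring
  rw [h2, h1]; ring

lemma sFactor_pos {Ω : Type*} [MeasurableSpace Ω] (P : Measure Ω) [IsProbabilityMeasure P]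
    (X : Ω → ℤ) (hX : Measurable X) (hnd : ∀ k, P {x | X x = k} < 1) : 0 < sFactor P X := by
  have hsub : ∀ k l, k ≤ l → intCdf P X k ≤ intCdf P X l := by
    intro k l hkl
    exact measureReal_mono (μ := P) (s₁ := {x | X x ≤ k}) (s₂ := {x | X x ≤ l})
      (fun x hx => le_trans hx hkl)
  have hms : ∀ k, MeasurableSet {x | X x = k} := fun k => hX (measurableSet_singleton k)
  have hmle : ∀ k, P.real {x | X x = k} ≤ intCdf P X k := by
    intro k
    rw [← intCdf_sub P X hX]
    linarith [intCdf_nonneg P X (k - 1)]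
  have key : ∀ k l, k < l → 0 < P.real {x | X x = k} → 0 < P.real {x | X x = l} →
      0 < sFactor P X := by
    intro k l hkl hk hl
    have hb2 : ∀ k, |intCdf P X k * intCdf P X (k - 1)| ≤ 1 := by
      intro k
      have h1 := intCdf_nonneg P X k
      have h2 := intCdf_nonneg P X (k - 1)
      rw [abs_of_nonneg (by positivity)]
      exact mul_le_one₀ (intCdf_le_one P X k) h2 (intCdf_le_one P X (k - 1))
    have hint := integrable_of_int P X hX _ _ hb2
    have h1 : ∫ x in {x | X x = l}, intCdf P X (X x) * intCdf P X (X x - 1) ∂P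
        ≤ sFactor P X :=
      setIntegral_le_integral hint
        (Eventually.of_forall fun x => mul_nonneg (intCdf_nonneg _ _ _) (intCdf_nonneg _ _ _))
    have h2 : ∫ x in {x | X x = l}, intCdf P X (X x) * intCdf P X (X x - 1) ∂P
        = P.real {x | X x = l} * (intCdf P X l * intCdf P X (l - 1)) := by
      rw [setIntegral_congr_fun (g := fun _ => intCdf P X l * intCdf P X (l - 1)) (hms l)]
      · simp
      · intro x hx
        simp only [Set.mem_setOf_eq] at hx
        simp only [hx]
    refine lt_of_lt_of_le ?_ h1
    rw [h2]
    have h3 := hmle l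
    have h4 := hmle k
    have h5 := hsub k (l - 1) (by omega)
    exact mul_pos hl (mul_pos (by linarith) (by linarith))
  have hex : ∀ s : Set Ω, P s ≠ 0 → ∃ k, P (s ∩ {x | X x = k}) ≠ 0 := by
    intro s hs
    by_contra! hcon
    apply hs
    have : s = ⋃ k, s ∩ {x | X x = k} := by
      ext x; simp
    rw [this]
    exact measure_iUnion_null hcon
  obtain ⟨k, hk⟩ := hex Set.univ (by simp)
  rw [Set.univ_inter] at hk
  have hkc : P ({x | X x = k}ᶜ) ≠ 0 := by
    intro h0
    rw [prob_compl_eq_zero_iff (hms k)] at h0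
    exact absurd h0 (hnd k).ne
  obtain ⟨l, hl⟩ := hex _ hkc
  have hkl : k ≠ l := by
    rintro rfl
    simp at hl
  have hl' : P {x | X x = l} ≠ 0 := fun h0 => hl (measure_mono_null Set.inter_subset_right h0)
  have pk : 0 < P.real {x | X x = k} := ENNReal.toReal_pos hk (measure_ne_top _ _)
  have pl : 0 < P.real {x | X x = l} := ENNReal.toReal_pos hl' (measure_ne_top _ _)
  rcases lt_or_gt_of_ne hkl with h | h
  · exact key k l h pk pl
  · exact key l k h pl pk

/-! ### The empirical measure of a multigraph -/

/-- Empirical measure of the degree pair at a uniformly chosen edge. -/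
noncomputable def empMeas {V : Type*} [Fintype V] (m : V × V → ℕ) (α β : Bool) :
    Measure (ℤ × ℤ) :=
  if edgeCount m = 0 then Measure.dirac 0 else
    ∑ e, ENNReal.ofReal ((m e : ℝ) / (edgeCount m : ℝ)) •
      Measure.dirac ((deg m α e.1 : ℤ), (deg m β e.2 : ℤ))

instance empMeas_prob {V : Type*} [Fintype V] (m : V × V → ℕ) (α β : Bool) :
    IsProbabilityMeasure (empMeas m α β) := by
  unfold empMeas
  split_ifs with h
  · infer_instance
  · constructor
    simp only [Measure.coe_finset_sum, Finset.sum_apply, Measure.smul_apply, measure_univ,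
      smul_eq_mul, mul_one]
    rw [← ENNReal.ofReal_sum_of_nonneg (fun e _ => by positivity), ← Finset.sum_div,
      ← Nat.cast_sum, ← ENNReal.ofReal_one]
    congr 1
    exact div_self (by exact_mod_cast h)

lemma integral_empMeas {V : Type*} [Fintype V] (m : V × V → ℕ) (α β : Bool)
    (hm : edgeCount m ≠ 0) (f : ℤ × ℤ → ℝ) :
    ∫ x, f x ∂(empMeas m α β)
      = ∑ e, (m e : ℝ) / (edgeCount m : ℝ) * f ((deg m α e.1 : ℤ), (deg m β e.2 : ℤ)) := by
  rw [empMeas, if_neg hm, integral_finset_sum_measure]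
  · refine Finset.sum_congr rfl fun e _ => ?_
    rw [integral_smul_measure, integral_dirac, ENNReal.toReal_ofReal (by positivity), smul_eq_mul]
  · intro e _
    exact (integrable_dirac (by simp)).smul_measure ENNReal.ofReal_ne_top

lemma empJointCdf_eq {V : Type*} [Fintype V] (m : V × V → ℕ) (α β : Bool)
    (hm : edgeCount m ≠ 0) (k l : ℤ) :
    intJointCdf (empMeas m α β) Prod.fst Prod.snd k l = empJointCdf m α β k l := by
  rw [intJointCdf_eq_integral _ _ _ measurable_fst measurable_snd, integral_empMeas m α β hm]
  rfl

lemma avgRank_eq {V : Type*} [Fintype V] (m : V × V → ℕ) (α β γ : Bool)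
    (hm : edgeCount m ≠ 0) (X : ℤ × ℤ → ℤ) (π : V × V → V)
    (hX : ∀ e : V × V, X ((deg m α e.1 : ℤ), (deg m β e.2 : ℤ)) = deg m γ (π e)) (e : V × V) :
    2 * avgRank m γ π e
      = edgeCount m * (2 - scriptF (empMeas m α β) X (deg m γ (π e))) + 1 := by
  have hN : (edgeCount m : ℝ) ≠ 0 := by exact_mod_cast hm
  have hXm : Measurable X := measurable_of_countable _
  have h2 : (edgeCount m : ℝ) * 2 = ∑ f, (m f : ℝ) * 2 := by
    rw [← Finset.sum_mul, edgeCount, Nat.cast_sum]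
  rw [scriptF, intCdf_eq_integral _ X hXm, intCdf_eq_integral _ X hXm,
    integral_empMeas m α β hm, integral_empMeas m α β hm, avgRank, mul_sub, h2,
    ← Finset.sum_add_distrib, Finset.mul_sum, ← Finset.sum_sub_distrib, mul_add, Finset.mul_sum,
    add_comm]
  congr 1
  · refine Finset.sum_congr rfl fun f _ => ?_
    rw [hX]
    field_simp
    split_ifs <;> first | omega | (field_simp; try norm_num)
  · norm_num

lemma sum_rank_eq {V : Type*} [Fintype V] (m : V × V → ℕ) (α β γ δ : Bool)
    (hm : edgeCount m ≠ 0) (X Y : ℤ × ℤ → ℤ) (π ϖ : V × V → V)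
    (hX : ∀ e : V × V, X ((deg m α e.1 : ℤ), (deg m β e.2 : ℤ)) = deg m γ (π e))
    (hY : ∀ e : V × V, Y ((deg m α e.1 : ℤ), (deg m β e.2 : ℤ)) = deg m δ (ϖ e)) :
    4 * ∑ e : V × V, (m e : ℝ) * avgRank m γ π e * avgRank m δ ϖ e -
      (edgeCount m : ℝ) * ((edgeCount m : ℝ) + 1) ^ 2
    = (edgeCount m : ℝ) ^ 3 * (∫ x, scriptF (empMeas m α β) X (X x) *
        scriptF (empMeas m α β) Y (Y x) ∂(empMeas m α β) - 1) := by
  have hN : (edgeCount m : ℝ) ≠ 0 := by exact_mod_cast hm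
  have iX := integral_scriptF (empMeas m α β) X (measurable_of_countable _)
  have iY := integral_scriptF (empMeas m α β) Y (measurable_of_countable _)
  rw [integral_empMeas m α β hm] at iX iY ⊢
  simp only [hX, hY] at iX iY ⊢
  set N : ℝ := (edgeCount m : ℝ) with hNdef
  set a : V × V → ℝ := fun e => scriptF (empMeas m α β) X (deg m γ (π e)) with ha
  set b : V × V → ℝ := fun e => scriptF (empMeas m α β) Y (deg m δ (ϖ e)) with hb
  have s0 : ∑ e, (m e : ℝ) = N := by rw [hNdef, edgeCount, Nat.cast_sum]
  have iX' : ∑ e, (m e : ℝ) * a e = N := by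
    have : ∑ e, (m e : ℝ) / N * a e = (∑ e, (m e : ℝ) * a e) / N := by
      rw [Finset.sum_div]; exact Finset.sum_congr rfl fun e _ => by ring
    rw [this] at iX
    field_simp at iX; linarith
  have iY' : ∑ e, (m e : ℝ) * b e = N := by
    have : ∑ e, (m e : ℝ) / N * b e = (∑ e, (m e : ℝ) * b e) / N := by
      rw [Finset.sum_div]; exact Finset.sum_congr rfl fun e _ => by ring
    rw [this] at iY
    field_simp at iY; linarith
  have hs : ∑ e, (m e : ℝ) / N * (a e * b e) = (∑ e, (m e : ℝ) * (a e * b e)) / N := by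
    rw [Finset.sum_div]; exact Finset.sum_congr rfl fun e _ => by ring
  have hL : 4 * ∑ e : V × V, (m e : ℝ) * avgRank m γ π e * avgRank m δ ϖ e
      = (2 * N + 1) ^ 2 * (∑ e, (m e : ℝ)) - (2 * N + 1) * N * (∑ e, (m e : ℝ) * a e)
        - (2 * N + 1) * N * (∑ e, (m e : ℝ) * b e) + N ^ 2 * ∑ e, (m e : ℝ) * (a e * b e) := by
    simp only [Finset.mul_sum]
    rw [← Finset.sum_sub_distrib, ← Finset.sum_sub_distrib, ← Finset.sum_add_distrib]
    refine Finset.sum_congr rfl fun e _ => ?_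
    have r1 : 2 * avgRank m γ π e = N * (2 - a e) + 1 := avgRank_eq m α β γ hm X π hX e
    have r2 : 2 * avgRank m δ ϖ e = N * (2 - b e) + 1 := avgRank_eq m α β δ hm Y ϖ hY e
    calc 4 * ((m e : ℝ) * avgRank m γ π e * avgRank m δ ϖ e)
        = (m e : ℝ) * (2 * avgRank m γ π e) * (2 * avgRank m δ ϖ e) := by ring
      _ = _ := by rw [r1, r2]; ring
  rw [hL, hs, s0, iX', iY']
  field_simp
  ring

/-- The statistic as a plug-in functional of the empirical measure. -/
noncomputable def plugIn (P : Measure (ℤ × ℤ)) : ℝ :=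
  (∫ x, scriptF P Prod.fst (x.1) * scriptF P Prod.snd (x.2) ∂P - 1) /
    (Real.sqrt (∫ x, scriptF P Prod.fst (x.1) * scriptF P Prod.fst (x.1) ∂P - 1) *
      Real.sqrt (∫ x, scriptF P Prod.snd (x.2) * scriptF P Prod.snd (x.2) ∂P - 1))

lemma rhoBarStat_eq {V : Type*} [Fintype V] (m : V × V → ℕ) (α β : Bool)
    (hm : edgeCount m ≠ 0) : rhoBarStat m α β = plugIn (empMeas m α β) := by
  have hN : (0 : ℝ) < edgeCount m := by exact_mod_cast Nat.pos_of_ne_zero hm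
  have h1 := sum_rank_eq m α β α β hm Prod.fst Prod.snd Prod.fst Prod.snd (fun _ => rfl)
    (fun _ => rfl)
  have h2 := sum_rank_eq m α β α α hm Prod.fst Prod.fst Prod.fst Prod.fst (fun _ => rfl)
    (fun _ => rfl)
  have h3 := sum_rank_eq m α β β β hm Prod.snd Prod.snd Prod.snd Prod.snd (fun _ => rfl)
    (fun _ => rfl)
  simp only [mul_assoc, ← pow_two] at h2 h3
  rw [rhoBarStat, plugIn, h1]
  simp only [← pow_two]
  rw [h2, h3, Real.sqrt_mul (by positivity), Real.sqrt_mul (by positivity)]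
  set N : ℝ := (edgeCount m : ℝ)
  rw [mul_mul_mul_comm, Real.mul_self_sqrt (by positivity),
    mul_div_mul_left _ _ (by positivity : N ^ 3 ≠ 0)]

/-- Convergence of the plug-in functional along an arbitrary filter. -/
lemma plugIn_tendsto {ι : Type*} {L : Filter ι} (P : ι → Measure (ℤ × ℤ))
    (Q : Measure (ℤ × ℤ)) [∀ i, IsProbabilityMeasure (P i)] [IsProbabilityMeasure Q]
    (h : ∀ k l, Tendsto (fun i => intJointCdf (P i) Prod.fst Prod.snd k l) L
      (nhds (intJointCdf Q Prod.fst Prod.snd k l)))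
    (hA : 0 < sFactor Q Prod.fst) (hB : 0 < sFactor Q Prod.snd) :
    Tendsto (fun i => plugIn (P i)) L (nhds (plugIn Q)) := by
  have hp : ∀ x, Tendsto (fun i => (P i).real {x}) L (nhds (Q.real {x})) := by
    intro x
    simp only [point_mass_eq]
    exact (((h _ _).sub (h _ _)).sub (h _ _)).add (h _ _)
  have hApos := sFactor_eq Q Prod.fst measurable_fst ▸ hA
  have hBpos := sFactor_eq Q Prod.snd measurable_snd ▸ hB
  refine Tendsto.div ((tendsto_EFF P Q hp Prod.fst Prod.snd).sub_const 1)
    ((((tendsto_EFF P Q hp Prod.fst Prod.fst).sub_const 1).sqrt).mul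
      (((tendsto_EFF P Q hp Prod.snd Prod.snd).sub_const 1).sqrt)) ?_
  exact ne_of_gt (mul_pos (Real.sqrt_pos.2 hApos) (Real.sqrt_pos.2 hBpos))

/-- The filter of events of asymptotic probability one. -/
def probFilter {Ω : Type*} [MeasurableSpace Ω] (μ : Measure Ω) : Filter (ℕ × Ω) where
  sets := {S | Tendsto (fun n => μ {ω | (n, ω) ∉ S}) atTop (nhds 0)}
  univ_sets := by simp
  sets_of_superset := by
    intro S T hS hST
    exact tendsto_of_tendsto_of_tendsto_of_le_of_le tendsto_const_nhds hS (fun _ => zero_le)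
      (fun n => measure_mono fun ω hω hS' => hω (hST hS'))
  inter_sets := by
    intro S T hS hT
    have := Tendsto.add hS hT
    rw [add_zero] at this
    refine tendsto_of_tendsto_of_tendsto_of_le_of_le tendsto_const_nhds this (fun _ => zero_le)
      (fun n => (measure_mono ?_).trans (measure_union_le _ _))
    intro ω hω
    simp only [Set.mem_setOf_eq, Set.mem_inter_iff, Set.mem_union] at hω ⊢
    tauto

lemma mem_probFilter {Ω : Type*} [MeasurableSpace Ω] (μ : Measure Ω) (S : Set (ℕ × Ω)) :
    S ∈ probFilter μ ↔ Tendsto (fun n => μ {ω | (n, ω) ∉ S}) atTop (nhds 0) := Iff.rfl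

lemma tendstoInMeasure_iff_probFilter {Ω : Type*} [MeasurableSpace Ω] (μ : Measure Ω)
    (f : ℕ → Ω → ℝ) (c : ℝ) :
    TendstoInMeasure μ f atTop (fun _ => c) ↔
      Tendsto (fun i : ℕ × Ω => f i.1 i.2) (probFilter μ) (nhds c) := by
  rw [tendstoInMeasure_iff_dist, Metric.tendsto_nhds]
  refine forall₂_congr fun ε _ => ?_
  rw [Filter.Eventually, mem_probFilter]
  simp only [Set.mem_setOf_eq, not_lt]

end Aux

/-- Under the regularity condition and `|E_n| → ∞` in probability,
Spearman's rho with average-rank tie resolution converges in probability to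
`ρ(𝒟^α,𝒟^β)/(3·√(S_{𝒟^α}·S_{𝒟^β}))`, where `S_X = E[F_X(X)F_X(X−1)]`. -/
theorem rhoBar_consistency
    {Ω : Type*} [MeasurableSpace Ω] (μ : Measure Ω) [IsProbabilityMeasure μ]
    {Ω' : Type*} [MeasurableSpace Ω'] (μ' : Measure Ω') [IsProbabilityMeasure μ']
    (α β : Bool)
    (M : (n : ℕ) → Ω → (Fin n × Fin n → ℕ))
    (hM : ∀ n, Measurable (M n))
    (DA DB : Ω' → ℤ) (hDA : Measurable DA) (hDB : Measurable DB)
    (hndA : ∀ k, μ' {ω | DA ω = k} < 1)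
    (hndB : ∀ l, μ' {ω | DB ω = l} < 1)
    (hEinf : ∀ K : ℕ, Tendsto (fun n => μ {ω | edgeCount (M n ω) < K}) atTop (nhds 0))
    (hH : ∀ k l : ℤ, TendstoInMeasure μ (fun n ω => empJointCdf (M n ω) α β k l) atTop
      (fun _ => intJointCdf μ' DA DB k l)) :
    TendstoInMeasure μ (fun n ω => rhoBarStat (M n ω) α β) atTop
      (fun _ => spearman μ' DA DB /
        (3 * Real.sqrt (sFactor μ' DA * sFactor μ' DB))) := by
  have hXY : Measurable (fun ω => (DA ω, DB ω)) := hDA.prodMk hDB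
  let Q : Measure (ℤ × ℤ) := μ'.map (fun ω => (DA ω, DB ω))
  have hQ : IsProbabilityMeasure Q := Measure.isProbabilityMeasure_map hXY.aemeasurable
  have hms : ∀ s : Set (ℤ × ℤ), MeasurableSet s := fun s => s.to_countable.measurableSet
  have hQs : ∀ s : Set (ℤ × ℤ), Q s = μ' ((fun ω => (DA ω, DB ω)) ⁻¹' s) := fun s =>
    Measure.map_apply hXY (hms s)
  have cA : ∀ k, intCdf Q Prod.fst k = intCdf μ' DA k := fun k => by
    rw [intCdf, hQs]; rfl
  have cB : ∀ k, intCdf Q Prod.snd k = intCdf μ' DB k := fun k => by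
    rw [intCdf, hQs]; rfl
  have cJ : ∀ k l, intJointCdf Q Prod.fst Prod.snd k l = intJointCdf μ' DA DB k l := fun k l => by
    rw [intJointCdf, hQs]; rfl
  have hint : ∀ f : ℤ × ℤ → ℝ, ∫ x, f x ∂Q = ∫ ω, f (DA ω, DB ω) ∂μ' := fun f =>
    integral_map hXY.aemeasurable (measurable_of_countable f).aestronglyMeasurable
  have sA : sFactor Q Prod.fst = sFactor μ' DA := by
    simp only [sFactor, cA, hint]
  have sB : sFactor Q Prod.snd = sFactor μ' DB := by
    simp only [sFactor, cB, hint]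
  have pA : 0 < sFactor μ' DA := sFactor_pos μ' DA hDA hndA
  have pB : 0 < sFactor μ' DB := sFactor_pos μ' DB hDB hndB
  have hlim : spearman μ' DA DB / (3 * Real.sqrt (sFactor μ' DA * sFactor μ' DB)) = plugIn Q := by
    have e1 := sFactor_eq Q Prod.fst measurable_fst
    have e2 := sFactor_eq Q Prod.snd measurable_snd
    rw [plugIn, ← e1, ← e2, sA, sB, Real.sqrt_mul pA.le, spearman, hint]
    simp only [scriptF, cA, cB]
    rw [← mul_div_mul_left _ (√(sFactor μ' DA) * √(sFactor μ' DB)) (three_ne_zero' ℝ)]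
    congr 1
    ring
  rw [hlim, tendstoInMeasure_iff_probFilter]
  have hpos : ∀ᶠ i : ℕ × Ω in probFilter μ, edgeCount (M i.1 i.2) ≠ 0 := by
    rw [Filter.Eventually, mem_probFilter]
    simpa using hEinf 1
  have hT := plugIn_tendsto (L := probFilter μ)
    (fun i : ℕ × Ω => empMeas (M i.1 i.2) α β) Q (by
      intro k l
      rw [cJ]
      refine ((tendstoInMeasure_iff_probFilter μ _ _).1 (hH k l)).congr' ?_
      filter_upwards [hpos] with i hi
      exact (empJointCdf_eq _ _ _ hi k l).symm) (sA ▸ pA) (sB ▸ pB)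
  refine hT.congr' ?_
  filter_upwards [hpos] with i hi
  exact (rhoBarStat_eq _ _ _ hi).symm
end
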